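/- arXiv:1702.04305 — 6 statements merged into one kernel-verified Lean document; each statement's English description precedes it below -/
import Mathlib

section
/- Let K be an algebraically closed field and let R be a prime affine K-algebra which is a finitely generated module over its center Z(R), with Z(R) integrally closed in its fraction field. Let tr : R → Z(R) be an almost representation theoretic trace with associated functions s_m : Irr_m(R) → K. Then for every positive integer ℓ, V(D_ℓ(R/Z(R),tr)) = V(MD_ℓ(R/Z(R),tr)) = { m ∈ maxSpec Z(R) : Σ_{V ∈ Irr_m(R), s_m(V) ≠ 0} (dim_K V)² < ℓ }. -/
open TensorProduct

set_option synthInstance.maxHeartbeats 1600000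
set_option maxHeartbeats 3200000

noncomputable section

universe u v

/-- A (possibly noncommutative) ring is prime if `a R b = 0` implies `a = 0` or `b = 0`. -/
def IsPrimeRing (R : Type*) [Ring R] : Prop :=
  ∀ a b : R, (∀ r : R, a * r * b = 0) → a = 0 ∨ b = 0

/-- A `K`-algebra `R` is an algebra over its center. -/
instance centerAlgebra (K R : Type*) [CommSemiring K] [Semiring R] [Algebra K R] :
    Algebra (Subalgebra.center K R) R :=
  RingHom.toAlgebra' ((Subalgebra.center K R).val.toRingHom)
    (fun c x => (Subalgebra.mem_center_iff.mp c.2 x).symm)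

/-- The `m`-discriminant ideal of `R` over a central subalgebra `C`, with respect to a
trace-like map `tr : R → C`: the ideal of `C` generated by all determinants
`det [tr (y i * y j)]` for `m`-tuples `y` of elements of `R`. -/
def discIdeal {C : Type*} {R : Type*} [CommRing C] [Ring R] [Algebra C R] (m : ℕ)
    (tr : R →ₗ[C] C) : Ideal C :=
  Ideal.span { d : C | ∃ y : Fin m → R, d = Matrix.det (Matrix.of fun i j => tr (y i * y j)) }

/-- The modified `m`-discriminant ideal of `R` over a central subalgebra `C`: the ideal of `C`
generated by all determinants `det [tr (y i * y' j)]` for pairs of `m`-tuples `y`, `y'`. -/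
def mdiscIdeal {C : Type*} {R : Type*} [CommRing C] [Ring R] [Algebra C R] (m : ℕ)
    (tr : R →ₗ[C] C) : Ideal C :=
  Ideal.span { d : C | ∃ y y' : Fin m → R, d = Matrix.det (Matrix.of fun i j => tr (y i * y' j)) }

/-- The zero locus of an ideal `I` of `C` in the maximal spectrum of `C`. -/
def maxZeroLocus {C : Type*} [CommRing C] (I : Ideal C) : Set (Ideal C) :=
  { m | m.IsMaximal ∧ I ≤ m }

/-- A bundled representation (module) of a ring `R`. -/
structure ModRep (R : Type u) [Ring R] : Type (u + 1) where
  carrier : Type u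
  [acg : AddCommGroup carrier]
  [mod : Module R carrier]

attribute [instance] ModRep.acg ModRep.mod

/-- The `K`-dimension of a module over a `K`-algebra `R` (via restriction of scalars). -/
def dimOver (K : Type v) [Field K] (R : Type u) [Ring R] [Algebra K R]
    (W : Type u) [AddCommGroup W] [Module R W] : ℕ :=
  letI : Module K W := Module.compHom W (algebraMap K R)
  Module.finrank K W

/-- Finite-dimensionality over `K` of a module over a `K`-algebra `R`. -/
def finDimOver (K : Type v) [Field K] (R : Type u) [Ring R] [Algebra K R]
    (W : Type u) [AddCommGroup W] [Module R W] : Prop :=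
  letI : Module K W := Module.compHom W (algebraMap K R)
  FiniteDimensional K W

/-- The trace over `K` of the action of `a : R` on a module `W` over the `K`-algebra `R`. -/
def traceOver (K : Type v) [Field K] (R : Type u) [Ring R] [Algebra K R]
    (W : Type u) [AddCommGroup W] [Module R W] (a : R) : K :=
  letI : Module K W := Module.compHom W (algebraMap K R)
  LinearMap.trace K W
    { toFun := fun w => a • w
      map_add' := fun v w => smul_add a v w
      map_smul' := fun k w => by
        show a • (algebraMap K R k • w) = algebraMap K R k • (a • w)
        rw [smul_smul, smul_smul, Algebra.commutes] }

def repDim (K : Type v) [Field K] {R : Type u} [Ring R] [Algebra K R] (V : ModRep R) : ℕ :=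
  dimOver K R V.carrier

def repFinDim (K : Type v) [Field K] {R : Type u} [Ring R] [Algebra K R] (V : ModRep R) : Prop :=
  finDimOver K R V.carrier

def repTrace (K : Type v) [Field K] {R : Type u} [Ring R] [Algebra K R]
    (V : ModRep R) (a : R) : K :=
  traceOver K R V.carrier a

/-- A representation of `R` is annihilated by the ideal `m` of the central subalgebra `C`. -/
def killedBy {C : Type*} {R : Type u} [CommRing C] [Ring R] [Algebra C R]
    (V : ModRep R) (m : Ideal C) : Prop :=
  ∀ z : C, z ∈ m → ∀ v : V.carrier, algebraMap C R z • v = 0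

open scoped Classical


theorem aux_density {K R ι : Type*} [Field K] [IsAlgClosed K] [Ring R] [Algebra K R]
    (W : ι → Type*) [∀ i, AddCommGroup (W i)] [∀ i, Module K (W i)] [∀ i, Module R (W i)]
    [∀ i, IsScalarTower K R (W i)] [Fintype ι] [∀ i, FiniteDimensional K (W i)]
    [∀ i, IsSimpleModule R (W i)]
    (hn : ∀ i j, i ≠ j → ¬ Nonempty (W i ≃ₗ[R] W j))
    (f : ∀ i, W i →ₗ[K] W i) : ∃ r : R, ∀ i (w : W i), r • w = f i w := by
  have key : ∀ g : Module.End R (Π₀ i, W i), ∃ c : ι → K, ∀ v i, (g v) i = c i • v i := by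
    intro g
    have h1 : ∀ i, ∃ c : K, ∀ x : W i, (g (DFinsupp.single i x)) i = c • x := by
      intro i
      obtain ⟨c, hc⟩ := (IsSimpleModule.algebraMap_end_bijective_of_isAlgClosed (A := R)
        (V := W i) K).2 (DFinsupp.lapply i ∘ₗ g ∘ₗ DFinsupp.lsingle i)
      refine ⟨c, fun x => ?_⟩
      have := congrArg (fun h => h x) hc
      simpa using! this.symm
    have h2 : ∀ i j, i ≠ j → ∀ x : W i, (g (DFinsupp.single i x)) j = 0 := by
      intro i j hij x
      rcases LinearMap.bijective_or_eq_zero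
        ((DFinsupp.lapply j : (Π₀ i, W i) →ₗ[R] W j) ∘ₗ g ∘ₗ DFinsupp.lsingle i) with h | h
      · exact absurd ⟨LinearEquiv.ofBijective _ h⟩ (hn i j hij)
      · have := congrArg (fun h => h x) h
        simpa using! this
    choose c hc using h1
    refine ⟨c, fun v i => ?_⟩
    induction v using DFinsupp.induction with
    | h0 => simp
    | ha j x v _ _ ih =>
      rw [map_add, DFinsupp.add_apply, ih, DFinsupp.add_apply, smul_add]
      congr 1
      by_cases h : j = i
      · subst h; simp [hc]
      · rw [h2 j i h, DFinsupp.single_eq_of_ne (Ne.symm h), smul_zero]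
  let F : Module.End (Module.End R (Π₀ i, W i)) (Π₀ i, W i) :=
    { toFun := fun v => DFinsupp.mapRange.linearMap f v
      map_add' := fun v w => map_add _ v w
      map_smul' := fun g v => by
        obtain ⟨c, hc⟩ := key g
        ext i
        simp [hc] }
  obtain ⟨r, hr⟩ := jacobson_density F
    (Finset.univ.biUnion fun i => Finset.univ.image fun k =>
      DFinsupp.single i (Module.finBasis K (W i) k))
  refine ⟨r, fun i w => ?_⟩
  have : (Module.toModuleEnd K (S := R) (W i) r : W i →ₗ[K] W i) = f i := by
    refine (Module.finBasis K (W i)).ext fun k => ?_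
    have := congrArg (fun v => v i) (hr (DFinsupp.single i (Module.finBasis K (W i) k)) (by
      simp only [Finset.mem_biUnion, Finset.mem_image, Finset.mem_univ, true_and]
      exact ⟨i, k, rfl⟩))
    simpa [F] using! this.symm
  rw [← this]; rfl

theorem aux_invol {J : Type*} [Fintype J] (σ : J → J) (hσ : ∀ x, σ (σ x) = x) (x₀ : J)
    (h₀ : σ x₀ = x₀) : ∀ l ≤ Fintype.card J, ∃ T : Finset J, T.card = l ∧ ∀ x ∈ T, σ x ∈ T := by
  intro l
  induction l using Nat.twoStepInduction with
  | zero => exact fun _ => ⟨∅, by simp⟩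
  | one => exact fun _ => ⟨{x₀}, by simp [h₀]⟩
  | more n ih _ =>
    intro hl
    obtain ⟨T, hT, hi⟩ := ih (by omega)
    by_cases h : ∃ y, y ∉ T ∧ σ y ≠ y
    · obtain ⟨y, hy, hy'⟩ := h
      have hy2 : σ y ∉ T := fun h => hy (by simpa [hσ] using hi _ h)
      refine ⟨insert y (insert (σ y) T), ?_, ?_⟩
      · rw [Finset.card_insert_of_notMem (by simp [hy, Ne.symm hy']),
          Finset.card_insert_of_notMem hy2, hT]
      · intro x hx
        simp only [Finset.mem_insert] at hx ⊢
        rcases hx with rfl | rfl | hx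
        · simp
        · simp [hσ]
        · simp [hi x hx]
    · push Not at h
      obtain ⟨U, hTU, hU⟩ := Finset.exists_superset_card_eq (s := T) (n := n + 2) (by omega) hl
      refine ⟨U, hU, fun x hx => ?_⟩
      by_cases hxT : x ∈ T
      · exact hTU (hi x hxT)
      · rwa [h x hxT]

/-- the linear-algebra core -/
theorem aux_core {K R ι : Type*} [Field K] [Ring R] [Fintype ι] (d : ι → ℕ)
    (hd : ∀ i, 0 < d i) (s : ι → K) (hs : ∀ i, s i ≠ 0)
    (φ : R → ∀ i, Matrix (Fin (d i)) (Fin (d i)) K) (hφ : Function.Surjective φ)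
    (β : R → R → K) (hβ : ∀ a b, β a b = ∑ i, s i * (φ a i * φ b i).trace)
    (l : ℕ) (hl : 0 < l) :
    ((∑ i, d i ^ 2) < l → ∀ y y' : Fin l → R, (Matrix.of fun i j => β (y i) (y' j)).det = 0) ∧
    (l ≤ (∑ i, d i ^ 2) → ∃ y : Fin l → R, (Matrix.of fun i j => β (y i) (y j)).det ≠ 0) := by
  let J := Σ i, Fin (d i) × Fin (d i)
  have hJ : Fintype.card J = ∑ i, d i ^ 2 := by
    simp [J, sq]
  have hβ' : ∀ a b, β a b = ∑ p : J, (s p.1 * φ a p.1 p.2.1 p.2.2) * φ b p.1 p.2.2 p.2.1 := by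
    intro a b
    rw [hβ, Fintype.sum_sigma]
    refine Finset.sum_congr rfl fun i _ => ?_
    rw [Fintype.sum_prod_type, Matrix.trace, Finset.mul_sum]
    refine Finset.sum_congr rfl fun j _ => ?_
    simp [Matrix.mul_apply, Finset.mul_sum, mul_assoc]
  constructor
  · intro hlt y y'
    by_contra hne
    have h1 : (Matrix.of fun i j => β (y i) (y' j)) =
        (Matrix.of fun (i : Fin l) (p : J) => s p.1 * φ (y i) p.1 p.2.1 p.2.2) *
        (Matrix.of fun (p : J) (j : Fin l) => φ (y' j) p.1 p.2.2 p.2.1) := by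
      ext i j
      simp [Matrix.mul_apply, hβ']
    have h2 := Matrix.rank_of_isUnit _ ((Matrix.isUnit_iff_isUnit_det _).2 (isUnit_iff_ne_zero.2 hne))
    rw [h1] at h2
    have h3 := (Matrix.rank_mul_le_left
        (Matrix.of fun (i : Fin l) (p : J) => s p.1 * φ (y i) p.1 p.2.1 p.2.2)
        (Matrix.of fun (p : J) (j : Fin l) => φ (y' j) p.1 p.2.2 p.2.1)).trans
        (Matrix.rank_le_card_width _)
    rw [h2, hJ] at h3
    simp at h3
    omega
  · intro hle
    let σ : J → J := fun p => ⟨p.1, p.2.2, p.2.1⟩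
    have hσ : ∀ p, σ (σ p) = p := fun p => rfl
    have hne : Nonempty ι := by
      by_contra h
      rw [not_nonempty_iff] at h
      simp at hle; omega
    obtain ⟨i₀⟩ := hne
    obtain ⟨T, hT, hTi⟩ := aux_invol σ hσ ⟨i₀, ⟨0, hd i₀⟩, ⟨0, hd i₀⟩⟩ rfl l (hJ ▸ hle)
    let e : Fin l ≃ T := (finCongr hT.symm).trans T.equivFin.symm
    choose ψ hψ using hφ
    let E : J → R := fun p => ψ (Pi.single p.1 (Matrix.single p.2.1 p.2.2 1))
    have hE : ∀ p q : J, β (E p) (E q) = if q = σ p then s p.1 else 0 := by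
      rintro ⟨i, j, k⟩ ⟨i', j', k'⟩
      rw [hβ]
      simp only [E, hψ]
      rw [Finset.sum_eq_single i]
      · by_cases hi : i' = i
        · subst hi
          by_cases hk : j' = k
          · subst hk
            by_cases hk' : k' = j
            · subst hk'
              simp [σ]
            · rw [if_neg (by intro h; cases h; exact hk' rfl)]
              simp [Matrix.trace_single_eq_of_ne _ _ _ (Ne.symm hk')]
          · rw [if_neg (by intro h; cases h; exact hk rfl)]
            simp [Matrix.single_mul_single_of_ne _ _ _ _ (Ne.symm hk)]
        · rw [Pi.single_eq_of_ne (Ne.symm hi), if_neg]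
          · simp
          · intro h; exact hi (congrArg Sigma.fst h)
      · intro b _ hb
        rw [Pi.single_eq_of_ne hb]; simp
      · simp
    refine ⟨fun a => E (e a), fun hdet => ?_⟩
    obtain ⟨v, hv, hv0⟩ := Matrix.exists_mulVec_eq_zero_iff.2 hdet
    apply hv
    funext a
    let b : Fin l := e.symm ⟨σ (e a), hTi _ (e a).2⟩
    have hb : (e b : J) = σ (e a) := by simp [b]
    have h := congrFun hv0 b
    simp only [Matrix.mulVec, dotProduct, Matrix.of_apply, hE, hb, hσ, Pi.zero_apply] at h
    rw [Finset.sum_eq_single a] at h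
    · simpa [hs] using h
    · intro c _ hc
      rw [if_neg, zero_mul]
      intro hh
      exact hc (e.injective (Subtype.ext hh))
    · simp

theorem aux_rep {K R : Type u} [Field K] [IsAlgClosed K] [Ring R] [Algebra K R]
    {n : Type*} [Fintype n] (V : n → ModRep R) (s : n → K)
    (hsimple : ∀ i, IsSimpleModule R (V i).carrier)
    (hnoniso : ∀ i j, i ≠ j → ¬ Nonempty ((V i).carrier ≃ₗ[R] (V j).carrier))
    (l : ℕ) (hl : 0 < l) :
    ((∑ i ∈ Finset.univ.filter (fun i => s i ≠ 0), (repDim K (V i)) ^ 2) < l →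
      ∀ y y' : Fin l → R,
        (Matrix.of fun i j => ∑ k, s k * repTrace K (V k) (y i * y' j)).det = 0) ∧
    (l ≤ (∑ i ∈ Finset.univ.filter (fun i => s i ≠ 0), (repDim K (V i)) ^ 2) →
      ∃ y : Fin l → R,
        (Matrix.of fun i j => ∑ k, s k * repTrace K (V k) (y i * y j)).det ≠ 0) := by
  letI instK : ∀ i, Module K (V i).carrier :=
    fun i => Module.compHom (V i).carrier (algebraMap K R)
  haveI : ∀ i, IsScalarTower K R (V i).carrier := fun i =>
    ⟨fun k r w => by rw [Algebra.smul_def, mul_smul]; rfl⟩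
  let P : n → Prop := fun i => s i ≠ 0 ∧ FiniteDimensional K (V i).carrier
  let ι := {i : n // P i}
  haveI : ∀ i : ι, FiniteDimensional K (V i.1).carrier := fun i => i.2.2
  have htrace : ∀ i a, repTrace K (V i) a = LinearMap.trace K (V i).carrier
      (Module.toModuleEnd K (S := R) (V i).carrier a) := fun i a => rfl
  have hdim : ∀ i, repDim K (V i) = Module.finrank K (V i).carrier := fun i => rfl
  let d : ι → ℕ := fun i => Module.finrank K (V i.1).carrier
  let φ : R → ∀ i : ι, Matrix (Fin (d i)) (Fin (d i)) K := fun a i =>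
    LinearMap.toMatrix (Module.finBasis K (V i.1).carrier) (Module.finBasis K (V i.1).carrier)
      (Module.toModuleEnd K (S := R) (V i.1).carrier a)
  have hsum : (∑ i ∈ Finset.univ.filter (fun i => s i ≠ 0), (repDim K (V i)) ^ 2) =
      ∑ i : ι, d i ^ 2 := by
    rw [← Finset.sum_subtype (Finset.univ.filter P) (by simp)
      (fun i => Module.finrank K (V i).carrier ^ 2)]
    symm
    refine Finset.sum_subset ?_ ?_
    · intro i hi
      simp only [Finset.mem_filter, Finset.mem_univ, true_and] at hi ⊢
      exact hi.1
    · intro i hi hi'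
      simp only [Finset.mem_filter, Finset.mem_univ, true_and] at hi hi'
      have : ¬ FiniteDimensional K (V i).carrier := fun h => hi' ⟨hi, h⟩
      rw [Module.finrank_of_not_finite this]; simp
  have hβ : ∀ a b : R, (∑ k, s k * repTrace K (V k) (a * b)) =
      ∑ i : ι, s i.1 * (φ a i * φ b i).trace := by
    intro a b
    have h1 : ∀ i : ι, s i.1 * (φ a i * φ b i).trace = s i.1 * repTrace K (V i.1) (a * b) := by
      intro i
      rw [htrace, map_mul, LinearMap.trace_eq_matrix_trace K (Module.finBasis K (V i.1).carrier),
        LinearMap.toMatrix_mul]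
    rw [Finset.sum_congr rfl fun i _ => h1 i]
    rw [← Finset.sum_subtype (Finset.univ.filter P) (by simp)
      (fun i => s i * repTrace K (V i) (a * b))]
    symm
    refine Finset.sum_subset (Finset.subset_univ _) ?_
    intro i _ hi'
    simp only [Finset.mem_filter, Finset.mem_univ, true_and] at hi'
    by_cases hs : s i = 0
    · simp [hs]
    · have : ¬ FiniteDimensional K (V i).carrier := fun h => hi' ⟨hs, h⟩
      rw [htrace, LinearMap.trace, dif_neg, LinearMap.zero_apply, mul_zero]
      rintro ⟨u, ⟨b⟩⟩
      exact this (Module.Finite.of_basis b)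
  have hsurj : Function.Surjective φ := by
    intro M
    obtain ⟨r, hr⟩ := aux_density (K := K) (R := R) (fun i : ι => (V i.1).carrier)
      (fun i j hij => hnoniso i.1 j.1 (fun h => hij (Subtype.ext h)))
      (fun i => Matrix.toLin (Module.finBasis K (V i.1).carrier)
        (Module.finBasis K (V i.1).carrier) (M i))
    refine ⟨r, funext fun i => ?_⟩
    have : (Module.toModuleEnd K (S := R) (V i.1).carrier r : (V i.1).carrier →ₗ[K] _) =
        Matrix.toLin (Module.finBasis K (V i.1).carrier)
        (Module.finBasis K (V i.1).carrier) (M i) := LinearMap.ext fun w => hr i w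
    simp only [φ]
    rw [this, LinearMap.toMatrix_toLin]
  have hd : ∀ i, 0 < d i := fun i => by
    haveI := IsSimpleModule.nontrivial R (V i.1).carrier
    exact Module.finrank_pos
  rw [hsum]
  exact aux_core d hd (fun i => s i.1) (fun i => i.2.1) φ hsurj
    (fun a b => ∑ k, s k * repTrace K (V k) (a * b)) hβ l hl

theorem aux_mod {K C : Type*} [Field K] [CommRing C] [Algebra K C] (m : Ideal C)
    (hm : m.IsMaximal) {l : ℕ} (A : Matrix (Fin l) (Fin l) C) (B : Matrix (Fin l) (Fin l) K)
    (h : ∀ i j, A i j - algebraMap K C (B i j) ∈ m) : A.det ∈ m ↔ B.det = 0 := by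
  haveI := hm
  rw [← Ideal.Quotient.eq_zero_iff_mem, RingHom.map_det]
  have : (Ideal.Quotient.mk m).mapMatrix A =
      ((Ideal.Quotient.mk m).comp (algebraMap K C)).mapMatrix B := by
    ext i j
    simpa using! Ideal.Quotient.eq.2 (h i j)
  rw [this, ← RingHom.map_det]
  exact map_eq_zero_iff _ (RingHom.injective _)

/-- **Main Theorem (d) of Brown–Yakimov**: let `R` be a prime affine algebra over an
algebraically closed field `K`, a finitely generated module over its center `Z(R)`, with
`Z(R)` integrally closed in its fraction field, and let `tr : R → Z(R)` be an almost
representation theoretic trace with associated scalars `s`. Then for every positive integer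
`ℓ`, the zero sets of the `ℓ`-discriminant and modified `ℓ`-discriminant ideals coincide and
equal the set of maximal ideals `m` of `Z(R)` with
`∑_{V ∈ Irr_m(R), s_m(V) ≠ 0} (dim_K V)² < ℓ`. -/
theorem discriminant_zero_locus_eq_small_dimension_locus
    {K R : Type u} [Field K] [IsAlgClosed K] [Ring R] [Algebra K R]
    [Algebra.FiniteType K R] (hprime : IsPrimeRing R)
    [Module.Finite (Subalgebra.center K R) R]
    [IsIntegrallyClosed (Subalgebra.center K R)]
    (tr : R →ₗ[Subalgebra.center K R] Subalgebra.center K R)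
    (htr0 : tr ≠ 0) (hcyc : ∀ x y : R, tr (x * y) = tr (y * x))
    -- data of an almost representation theoretic trace: for each maximal ideal `m` of the
    -- center, a complete irredundant family `V m` of simple `R`-modules annihilated by `m`
    -- and scalars `s m` with `tr ≡ ∑ i, s m i • tr_{V m i}` modulo `m`
    (t : Ideal (Subalgebra.center K R) → ℕ)
    (V : ∀ m : Ideal (Subalgebra.center K R), Fin (t m) → ModRep R)
    (s : ∀ m : Ideal (Subalgebra.center K R), Fin (t m) → K)
    (hsimple : ∀ m : Ideal (Subalgebra.center K R), m.IsMaximal →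
      ∀ i, IsSimpleModule R (V m i).carrier)
    (hkill : ∀ m : Ideal (Subalgebra.center K R), m.IsMaximal → ∀ i, killedBy (V m i) m)
    (hnoniso : ∀ m : Ideal (Subalgebra.center K R), m.IsMaximal →
      ∀ i j, i ≠ j → ¬ Nonempty ((V m i).carrier ≃ₗ[R] (V m j).carrier))
    (hexh : ∀ m : Ideal (Subalgebra.center K R), m.IsMaximal →
      ∀ (W : Type u) [AddCommGroup W] [Module R W], IsSimpleModule R W →
        (∀ z : Subalgebra.center K R, z ∈ m →
          ∀ w : W, algebraMap (Subalgebra.center K R) R z • w = 0) →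
        ∃ i, Nonempty (W ≃ₗ[R] (V m i).carrier))
    (htr : ∀ m : Ideal (Subalgebra.center K R), m.IsMaximal → ∀ a : R,
      tr a - algebraMap K (Subalgebra.center K R) (∑ i, s m i * repTrace K (V m i) a) ∈ m)
    (ℓ : ℕ) (hℓ : 0 < ℓ) :
    maxZeroLocus (discIdeal ℓ tr) = maxZeroLocus (mdiscIdeal ℓ tr) ∧
    maxZeroLocus (discIdeal ℓ tr) =
      { m : Ideal (Subalgebra.center K R) | m.IsMaximal ∧
        (∑ i ∈ Finset.univ.filter (fun i => s m i ≠ 0), (repDim K (V m i)) ^ 2) < ℓ } := by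
  have key : ∀ m : Ideal (Subalgebra.center K R), m.IsMaximal →
      ((∑ i ∈ Finset.univ.filter (fun i => s m i ≠ 0), (repDim K (V m i)) ^ 2) < ℓ →
        mdiscIdeal ℓ tr ≤ m) ∧
      (discIdeal ℓ tr ≤ m →
        (∑ i ∈ Finset.univ.filter (fun i => s m i ≠ 0), (repDim K (V m i)) ^ 2) < ℓ) := by
    intro m hm
    obtain ⟨h1, h2⟩ := aux_rep (V m) (s m) (hsimple m hm) (hnoniso m hm) ℓ hℓ
    constructor
    · intro hlt
      refine Ideal.span_le.2 ?_
      rintro _ ⟨y, y', rfl⟩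
      exact (aux_mod m hm _ _ fun i j => htr m hm (y i * y' j)).2 (h1 hlt y y')
    · intro hle
      by_contra hlt
      obtain ⟨y, hy⟩ := h2 (not_lt.1 hlt)
      exact hy ((aux_mod m hm _ _ fun i j => htr m hm (y i * y j)).1
        (hle (Ideal.subset_span ⟨y, rfl⟩)))
  have hDM : discIdeal ℓ tr ≤ mdiscIdeal ℓ tr := by
    refine Ideal.span_mono ?_
    rintro _ ⟨y, rfl⟩
    exact ⟨y, y, rfl⟩
  constructor
  · ext m
    exact ⟨fun h => ⟨h.1, (key m h.1).1 ((key m h.1).2 h.2)⟩, fun h => ⟨h.1, hDM.trans h.2⟩⟩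
  · ext m
    exact ⟨fun h => ⟨h.1, (key m h.1).2 h.2⟩, fun h => ⟨h.1, hDM.trans ((key m h.1).1 h.2)⟩⟩
end
end

section
/- Let K be an algebraically closed field, R a prime K-algebra which is a finitely generated module over its affine center Z(R), tr : R → Z(R) a trace map, and n the PI degree of R (so dim_Q(R ⊗_{Z(R)} Q) = n², Q the fraction field of Z(R)). Then MD_m(R/Z(R),tr) = 0, and hence D_m(R/Z(R),tr) = 0, for every integer m > n². -/
open TensorProduct

set_option synthInstance.maxHeartbeats 1600000
set_option maxHeartbeats 3200000

noncomputable section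

universe u v

/-- Determinants of size larger than the generic rank vanish. -/
theorem det_eq_zero_of_finrank_lt {C R : Type u} [CommRing C] [IsDomain C] [Ring R] [Algebra C R]
    (hfin : Module.Finite C R) (m : ℕ)
    (h : Module.finrank (FractionRing C) ((FractionRing C) ⊗[C] R) < m)
    (tr : R →ₗ[C] C) (y y' : Fin m → R) :
    Matrix.det (Matrix.of fun i j => tr (y i * y' j)) = 0 := by
  have hdep : ¬ LinearIndependent (FractionRing C)
      (fun i : Fin m => (1 : FractionRing C) ⊗ₜ[C] (y i)) := by
    intro hli
    have := hli.fintype_card_le_finrank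
    simp at this
    omega
  rw [Fintype.not_linearIndependent_iff] at hdep
  obtain ⟨g, hg, i0, hi0⟩ := hdep
  apply FaithfulSMul.algebraMap_injective C (FractionRing C)
  rw [map_zero, RingHom.map_det]
  apply Matrix.exists_vecMul_eq_zero_iff.mp
  refine ⟨g, fun h0 => hi0 (congrFun h0 i0), ?_⟩
  funext j
  let f : (FractionRing C) ⊗[C] R →ₗ[FractionRing C] (FractionRing C) ⊗[C] C :=
    (tr ∘ₗ LinearMap.mulRight C (y' j)).baseChange (FractionRing C)
  have := congrArg (TensorProduct.AlgebraTensorModule.rid C (FractionRing C) (FractionRing C))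
    (congrArg f hg)
  simp only [map_sum, map_smul, f, LinearMap.baseChange_tmul, map_zero] at this
  simp [Algebra.smul_def] at this
  simpa [Matrix.vecMul, dotProduct] using this

/-- The center of a nontrivial prime ring is a domain. -/
theorem center_isDomain {K R : Type u} [Field K] [Ring R] [Algebra K R] [Nontrivial R]
    (hprime : IsPrimeRing R) : IsDomain (Subalgebra.center K R) := by
  have : NoZeroDivisors (Subalgebra.center K R) := by
    refine ⟨fun {a b} hab => ?_⟩
    have hab' : (a : R) * b = 0 := congrArg Subtype.val hab
    have := hprime a b (fun r => by
      rw [← Subalgebra.mem_center_iff.mp a.2 r, mul_assoc, hab', mul_zero])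
    rcases this with h | h
    · exact Or.inl (Subtype.ext h)
    · exact Or.inr (Subtype.ext h)
  exact NoZeroDivisors.to_isDomain _

/-- **Vanishing of high discriminant ideals** (Corollary of Posner's theorem; part (f) of the
Main Theorem of Brown–Yakimov): for a prime `K`-algebra `R` over an algebraically closed field
`K`, module-finite over its affine center `Z(R)`, with PI degree `n` (i.e.
`dim_Q (R ⊗_{Z(R)} Q) = n²` for `Q` the fraction field of `Z(R)`), and any trace map
`tr : R → Z(R)`, the modified `m`-discriminant ideal, and hence the `m`-discriminant ideal,
vanishes for every `m > n²`. -/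
theorem discriminant_ideals_vanish_above_PI_degree_squared
    {K R : Type u} [Field K] [IsAlgClosed K] [Ring R] [Algebra K R]
    (hprime : IsPrimeRing R)
    [Module.Finite (Subalgebra.center K R) R]
    (hZaff : Algebra.FiniteType K (Subalgebra.center K R))
    (n : ℕ) (hn : 0 < n)
    (hPI : Module.finrank (FractionRing (Subalgebra.center K R))
        ((FractionRing (Subalgebra.center K R)) ⊗[Subalgebra.center K R] R) = n ^ 2)
    (tr : R →ₗ[Subalgebra.center K R] Subalgebra.center K R)
    (htr0 : tr ≠ 0) (hcyc : ∀ x y : R, tr (x * y) = tr (y * x)) :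
    ∀ m : ℕ, n ^ 2 < m →
      mdiscIdeal m tr = ⊥ ∧ discIdeal m tr = ⊥ := by
  rename_i hfin
  intro m hm
  have hnt : Nontrivial R := by
    by_contra hc
    rw [not_nontrivial_iff_subsingleton] at hc
    exact htr0 (LinearMap.ext fun x => by rw [Subsingleton.elim x 0, map_zero, map_zero])
  have hdom : IsDomain (Subalgebra.center K R) := center_isDomain hprime
  have key : ∀ y y' : Fin m → R,
      Matrix.det (Matrix.of fun i j => tr (y i * y' j)) = 0 := fun y y' =>
    det_eq_zero_of_finrank_lt hfin m (lt_of_eq_of_lt hPI hm) tr y y'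
  constructor
  · refine Ideal.span_eq_bot.mpr ?_
    rintro d ⟨y, y', rfl⟩
    exact key y y'
  · refine Ideal.span_eq_bot.mpr ?_
    rintro d ⟨y, rfl⟩
    exact key y y
end
end

section
/- Let K be an algebraically closed field, R a prime affine K-algebra which is a finitely generated module over its center Z(R), and n the PI degree of R. For a maximal ideal m of Z(R), the following are equivalent: (i) R/mR is a semisimple algebra; (ii) mR is a maximal two-sided ideal of R; (iii) R/mR is isomorphic to the matrix algebra M_n(K). -/
open TensorProduct

set_option synthInstance.maxHeartbeats 1600000
set_option maxHeartbeats 3200000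

noncomputable section

universe u v

/-- The two-sided ideal `mR` of `R` generated by the image of an ideal `m` of the center. -/
def centralExtension {K R : Type*} [CommSemiring K] [Ring R] [Algebra K R]
    (m : Ideal (Subalgebra.center K R)) : TwoSidedIdeal R :=
  TwoSidedIdeal.span ((fun z : Subalgebra.center K R => (z : R)) '' (m : Set (Subalgebra.center K R)))

section Generic

variable {Z R : Type*} [CommRing Z] [Ring R] [Algebra Z R]

lemma aux_mul_mem (I J : Ideal Z) {x y : R} (hx : x ∈ I • (⊤ : Submodule Z R))
    (hy : y ∈ J • (⊤ : Submodule Z R)) : x * y ∈ (I * J) • (⊤ : Submodule Z R) := by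
  refine Submodule.smul_induction_on hx (fun a ha u _ => ?_) (fun u v hu hv => ?_)
  · refine Submodule.smul_induction_on hy (fun b hb v _ => ?_) (fun u v hu hv => ?_)
    · rw [smul_mul_smul_comm]
      exact Submodule.smul_mem_smul (Ideal.mul_mem_mul ha hb) trivial
    · rw [mul_add]; exact add_mem hu hv
  · rw [add_mul]; exact add_mem hu hv

lemma aux_mul_mem_left (I : Ideal Z) (x : R) {y : R}
    (hy : y ∈ I • (⊤ : Submodule Z R)) : x * y ∈ I • (⊤ : Submodule Z R) := by
  have := aux_mul_mem (⊤ : Ideal Z) I (x := x) (by simp) hy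
  simpa using this

lemma aux_mul_mem_right (I : Ideal Z) {x : R} (y : R)
    (hx : x ∈ I • (⊤ : Submodule Z R)) : x * y ∈ I • (⊤ : Submodule Z R) := by
  have := aux_mul_mem I (⊤ : Ideal Z) (y := y) hx (by simp)
  simpa using this

lemma aux_mono {I J : Ideal Z} (h : I ≤ J) {x : R} (hx : x ∈ I • (⊤ : Submodule Z R)) :
    x ∈ J • (⊤ : Submodule Z R) := Submodule.smul_mono_left h hx

/-- lifting idempotents modulo powers -/
lemma aux_lift (m : Ideal Z) (e : R) (he : e * e - e ∈ m • (⊤ : Submodule Z R)) (k : ℕ) :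
    ∃ f : R, f - e ∈ m • (⊤ : Submodule Z R) ∧
      f * f - f ∈ (m ^ (k + 1)) • (⊤ : Submodule Z R) := by
  induction k with
  | zero => exact ⟨e, by simp, by simpa using he⟩
  | succ k ih =>
    obtain ⟨f, h1, h2⟩ := ih
    refine ⟨3 * (f * f) - 2 * (f * f * f), ?_, ?_⟩
    · have h3 : (3 * (f * f) - 2 * (f * f * f)) - e = (1 - 2 * f) * (f * f - f) + (f - e) := by
        noncomm_ring
      rw [h3]
      refine add_mem (aux_mul_mem_left _ _ (aux_mono (Ideal.pow_le_self (by omega)) h2)) h1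
    · have h3 : (3 * (f * f) - 2 * (f * f * f)) * (3 * (f * f) - 2 * (f * f * f)) -
          (3 * (f * f) - 2 * (f * f * f)) =
          (4 * (f * f) - 4 * f - 3) * ((f * f - f) * (f * f - f)) := by
        noncomm_ring
      rw [h3]
      refine aux_mul_mem_left _ _ (aux_mono ?_ (aux_mul_mem _ _ h2 h2))
      rw [← pow_add]
      exact Ideal.pow_le_pow_right (by omega)

lemma aux_offdiag (m : Ideal Z) (k : ℕ) (e g : R)
    (he : e * e - e ∈ (m ^ k) • (⊤ : Submodule Z R))
    (hg : g * g - g ∈ (m ^ k) • (⊤ : Submodule Z R))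
    (h1 : ∀ x, e * x * g ∈ m • (⊤ : Submodule Z R)) (j : ℕ) (hj : j ≤ k) (x : R) :
    e * x * g ∈ (m ^ j) • (⊤ : Submodule Z R) := by
  induction j generalizing x with
  | zero => simp
  | succ j ih =>
    have hy := ih (by omega) x
    have key : ∀ y ∈ (m ^ j) • (⊤ : Submodule Z R),
        e * y * g ∈ (m ^ (j + 1)) • (⊤ : Submodule Z R) := by
      intro y hy
      refine Submodule.smul_induction_on hy (fun a ha u _ => ?_) (fun u v hu hv => ?_)
      · rw [mul_smul_comm, smul_mul_assoc, pow_succ, ← smul_eq_mul (m ^ j) m, Submodule.smul_assoc]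
        exact Submodule.smul_mem_smul ha (h1 u)
      · rw [mul_add, add_mul]; exact add_mem hu hv
    have h2 := key _ hy
    have h3 : e * x * g = e * (e * x * g) * g - (e * e - e) * (x * g * g)
        - e * x * (g * g - g) := by noncomm_ring
    rw [h3]
    refine sub_mem (sub_mem h2 ?_) ?_
    · exact aux_mul_mem_right _ _ (aux_mono (Ideal.pow_le_pow_right hj) he)
    · exact aux_mul_mem_left _ _ (aux_mono (Ideal.pow_le_pow_right hj) hg)

lemma aux_central (m : Ideal Z) (k : ℕ) (hk : 1 ≤ k) (e : R)
    (he : e * e - e ∈ (m ^ k) • (⊤ : Submodule Z R))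
    (h1 : ∀ x, e * x - x * e ∈ m • (⊤ : Submodule Z R)) (x : R) :
    e * x - x * e ∈ (m ^ k) • (⊤ : Submodule Z R) := by
  have he' : (1 - e) * (1 - e) - (1 - e) ∈ (m ^ k) • (⊤ : Submodule Z R) := by
    convert he using 1; noncomm_ring
  have he1 : e * e - e ∈ m • (⊤ : Submodule Z R) :=
    aux_mono (Ideal.pow_le_self (by omega)) he
  have ha := aux_offdiag m k e (1 - e) he he' (fun y => by
    have : e * y * (1 - e) = e * (e * y - y * e) - (e * e - e) * y := by noncomm_ring
    rw [this]
    exact sub_mem (aux_mul_mem_left _ _ (h1 y)) (aux_mul_mem_right _ _ he1)) k le_rfl x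
  have hb := aux_offdiag m k (1 - e) e he' he (fun y => by
    have : (1 - e) * y * e = - ((e * y - y * e) * e) - y * (e * e - e) := by noncomm_ring
    rw [this]
    exact sub_mem (neg_mem (aux_mul_mem_right _ _ (h1 y))) (aux_mul_mem_left _ _ he1)) k le_rfl x
  have : e * x - x * e = e * x * (1 - e) - (1 - e) * x * e := by noncomm_ring
  rw [this]
  exact sub_mem ha hb

/-- Artin-Rees: almost central elements are close to central elements. -/
lemma aux_artinRees [IsNoetherianRing Z] [Module.Finite Z R]
    (hZ : ∀ x : R, (∀ y, x * y = y * x) → ∃ z : Z, algebraMap Z R z = x) (m : Ideal Z) :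
    ∃ k : ℕ, 1 ≤ k ∧ ∀ x : R, (∀ y, x * y - y * x ∈ (m ^ k) • (⊤ : Submodule Z R)) →
      ∃ z : Z, x - algebraMap Z R z ∈ m • (⊤ : Submodule Z R) := by
  classical
  obtain ⟨s, hs⟩ := Module.Finite.fg_top (R := Z) (M := R)
  let φ : R →ₗ[Z] (s → R) := LinearMap.pi fun i =>
    LinearMap.mulRight Z (i : R) - LinearMap.mulLeft Z (i : R)
  have hφ : ∀ x i, φ x i = x * i - i * x := fun x i => rfl
  obtain ⟨c, hc⟩ := Ideal.exists_pow_inf_eq_pow_smul m (LinearMap.range φ)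
  refine ⟨c + 1, by omega, fun x hx => ?_⟩
  have h1 : φ x ∈ (m ^ (c + 1)) • (⊤ : Submodule Z (s → R)) := by
    rw [← LinearMap.sum_single_apply (φ := fun _ => R) (φ x)]
    refine sum_mem fun i _ => ?_
    have h2 := Submodule.mem_map_of_mem (f := LinearMap.single Z (fun _ : s => R) i) (hx i)
    rw [Submodule.map_smul''] at h2
    exact Submodule.smul_mono le_rfl le_top h2
  have h2 : φ x ∈ m ^ (c + 1) • (⊤ : Submodule Z (s → R)) ⊓ LinearMap.range φ :=
    ⟨h1, LinearMap.mem_range_self _ _⟩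
  rw [hc (c + 1) (by omega)] at h2
  have h3 : φ x ∈ m • LinearMap.range φ := by
    simp only [Nat.add_sub_cancel_left, pow_one] at h2
    exact Submodule.smul_mono le_rfl inf_le_right h2
  rw [LinearMap.range_eq_map, ← Submodule.map_smul''] at h3
  obtain ⟨y, hy, hxy⟩ := h3
  obtain ⟨z, hz⟩ := hZ (x - y) (by
    intro w
    have hw : w ∈ Submodule.span Z (s : Set R) := by rw [hs]; trivial
    induction hw using Submodule.span_induction with
    | mem w hw =>
      have := congrFun hxy ⟨w, hw⟩
      rw [hφ, hφ] at this
      simp only at this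
      rw [sub_mul, mul_sub]
      rw [sub_eq_sub_iff_add_eq_add] at this ⊢
      rw [← this, add_comm]
    | zero => simp
    | add a b _ _ ha hb => rw [mul_add, add_mul, ha, hb]
    | smul a b _ hb => rw [mul_smul_comm, hb, smul_mul_assoc])
  exact ⟨z, by rw [hz]; simpa using hy⟩

lemma aux_idem_central [IsNoetherianRing Z] [Module.Finite Z R]
    (hZ : ∀ x : R, (∀ y, x * y = y * x) → ∃ z : Z, algebraMap Z R z = x) (m : Ideal Z)
    (e : R) (he : e * e - e ∈ m • (⊤ : Submodule Z R))
    (h1 : ∀ x, e * x - x * e ∈ m • (⊤ : Submodule Z R)) :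
    ∃ z : Z, e - algebraMap Z R z ∈ m • (⊤ : Submodule Z R) := by
  obtain ⟨k, hk, H⟩ := aux_artinRees hZ m
  obtain ⟨f, hf, hff⟩ := aux_lift m e he (k - 1)
  rw [Nat.sub_add_cancel hk] at hff
  obtain ⟨z, hz⟩ := H f (aux_central m k hk f hff (fun x => by
    have : f * x - x * f = (f - e) * x - x * (f - e) + (e * x - x * e) := by noncomm_ring
    rw [this]
    exact add_mem (sub_mem (aux_mul_mem_right _ _ hf) (aux_mul_mem_left _ _ hf)) (h1 x)))
  exact ⟨z, by
    have : e - algebraMap Z R z = (f - algebraMap Z R z) - (f - e) := by abel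
    rw [this]; exact sub_mem hz hf⟩

/-- `1 ∉ mR` -/
lemma aux_one_notMem [Module.Finite Z R] (hinj : Function.Injective (algebraMap Z R))
    (m : Ideal Z) (hm : m ≠ ⊤) : (1 : R) ∉ m • (⊤ : Submodule Z R) := by
  intro h
  have htop : (⊤ : Submodule Z R) ≤ m • (⊤ : Submodule Z R) := fun x _ => by
    simpa using aux_mul_mem_left m x h
  obtain ⟨r, hr, hr0⟩ := Submodule.exists_sub_one_mem_and_smul_eq_zero_of_fg_of_le_smul m ⊤
    Module.Finite.fg_top htop
  have h1 := hr0 1 trivial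
  rw [Algebra.smul_def, mul_one] at h1
  have : r = 0 := hinj (by simpa using h1)
  subst this
  apply hm
  rw [Ideal.eq_top_iff_one]
  simpa using neg_mem hr

/-- Artin-Tate -/
lemma aux_artinTate (K : Type*) [Field K] [Algebra K Z] [Algebra K R] [IsScalarTower K Z R]
    [Algebra.FiniteType K R] [Module.Finite Z R] (hinj : Function.Injective (algebraMap Z R)) :
    Algebra.FiniteType K Z := by
  obtain ⟨B₀, h1, h2⟩ := exists_subalgebra_of_fg K Z R Algebra.FiniteType.out Module.Finite.fg_top
  have : Algebra.FiniteType K B₀ := B₀.fg_iff_finiteType.mp h1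
  have : IsNoetherianRing B₀ := Algebra.FiniteType.isNoetherianRing K B₀
  have : Module.Finite B₀ R := ⟨h2⟩
  have hN : IsNoetherian B₀ R := isNoetherian_of_isNoetherianRing_of_finite B₀ R
  have : IsNoetherian B₀ Z := isNoetherian_of_injective
    ((Algebra.linearMap Z R).restrictScalars B₀) hinj
  have : Module.Finite B₀ Z := inferInstance
  exact Algebra.FiniteType.trans (S := B₀) inferInstance inferInstance

lemma aux_residue (K : Type*) [Field K] [IsAlgClosed K] [Algebra K Z]
    [Algebra.FiniteType K Z] (m : Ideal Z) (hm : m.IsMaximal) (z : Z) :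
    ∃ c : K, z - algebraMap K Z c ∈ m := by
  let _ : Field (Z ⧸ m) := Ideal.Quotient.field m
  have : Module.Finite K (Z ⧸ m) := finite_of_finite_type_of_isJacobsonRing K (Z ⧸ m)
  obtain ⟨c, hc⟩ := (IsAlgClosed.algebraMap_bijective_of_isIntegral (k := K) (K := Z ⧸ m)).2
    (Ideal.Quotient.mk m z)
  exact ⟨c, by rw [← Ideal.Quotient.eq, ← hc]; rfl⟩

lemma aux_smul_mem_span (K : Type*) [Field K] [Algebra K Z] [Algebra K R] [IsScalarTower K Z R]
    (m : Ideal Z) (hres : ∀ z : Z, ∃ c : K, z - algebraMap K Z c ∈ m) (z : Z) (x : R) :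
    ∃ c : K, z • x - c • x ∈ m • (⊤ : Submodule Z R) := by
  obtain ⟨c, hc⟩ := hres z
  refine ⟨c, ?_⟩
  rw [← algebraMap_smul Z c x, ← sub_smul]
  exact Submodule.smul_mem_smul hc trivial

end Generic

section Rank

variable {Z R : Type*} [CommRing Z] [Ring R] [Algebra Z R]

/-- Capelli-type argument: matrix images have bounded size. -/
lemma aux_capelli {K : Type*} [Field K] [IsDomain Z] [Module.IsTorsionFree Z R]
    [Module.Finite Z R] (t : ℕ) (ht : 0 < t) (f : R →+* Matrix (Fin t) (Fin t) K)
    (hf : Function.Surjective f) : t * t ≤ Module.finrank Z R := by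
  classical
  choose g hg using hf
  let ε : Fin (t * t) ≃ Fin t × Fin t := finProdFinEquiv.symm
  let r : Fin (t * t) → R := fun l => g (Matrix.single (ε l).1 (ε l).2 1)
  by_contra hlt
  have hdep : ¬ LinearIndependent Z r := by
    intro h
    have := h.fintype_card_le_finrank
    rw [Fintype.card_fin] at this
    exact hlt this
  let T : Fin (t * t) → (R →ₗ[Z] R) := fun k => ∑ j : Fin t,
    LinearMap.mulLeft Z (g (Matrix.single j (ε k).1 1)) ∘ₗ
      LinearMap.mulRight Z (g (Matrix.single (ε k).2 j 1))
  have hT : ∀ k l, f (T k (r l)) = if k = l then 1 else 0 := by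
    intro k l
    have h1 : f (T k (r l)) = ∑ j : Fin t, Matrix.single j (ε k).1 1 *
        (Matrix.single (ε l).1 (ε l).2 1 * Matrix.single (ε k).2 j (1 : K)) := by
      simp [T, r, LinearMap.sum_apply, hg]
    rw [h1]
    split_ifs with h
    · subst h
      simp [Matrix.sum_single_one]
    · have : (ε k).1 ≠ (ε l).1 ∨ (ε k).2 ≠ (ε l).2 := by
        by_contra hh
        push Not at hh
        exact h (ε.injective (Prod.ext hh.1 hh.2))
      refine Finset.sum_eq_zero fun j _ => ?_
      rcases this with h | h
      · rw [← mul_assoc, Matrix.single_mul_single_of_ne _ _ _ _ h, zero_mul]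
      · rw [Matrix.single_mul_single_of_ne _ _ _ _ h.symm, mul_zero]
  let F : R [⋀^Fin (t * t)]→ₗ[Z] R := MultilinearMap.alternatization
    ((MultilinearMap.mkPiAlgebraFin Z (t * t) R).compLinearMap T)
  have hF : F r = 0 := AlternatingMap.map_linearDependent F r hdep
  have hF2 : F r = ∑ σ : Equiv.Perm (Fin (t * t)), Equiv.Perm.sign σ •
      (List.ofFn fun k => T k (r (σ k))).prod := by
    simp only [F, MultilinearMap.alternatization_apply]
    rfl
  have hF3 : f (F r) = 1 := by
    rw [hF2, map_sum, Finset.sum_eq_single 1]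
    · rw [Equiv.Perm.sign_one, one_smul, map_list_prod, List.map_ofFn]
      apply List.prod_eq_one
      intro x hx
      rw [List.mem_ofFn] at hx
      obtain ⟨k, rfl⟩ := hx
      simp [hT]
    · intro σ _ hσ
      obtain ⟨k, hk⟩ : ∃ k, σ k ≠ k := by
        by_contra hh
        push Not at hh
        exact hσ (Equiv.ext hh)
      have : f (List.ofFn fun k => T k (r (σ k))).prod = 0 := by
        rw [map_list_prod, List.map_ofFn]
        apply List.prod_eq_zero
        rw [List.mem_ofFn]
        exact ⟨k, by simp [hT, hk.symm]⟩
      rw [Units.smul_def, map_zsmul, this, smul_zero]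
    · simp
  rw [hF, map_zero] at hF3
  have : Nonempty (Fin t) := ⟨⟨0, ht⟩⟩
  exact zero_ne_one hF3

lemma aux_generic_le {K : Type*} [Field K] [Algebra K Z] [Algebra K R] [IsScalarTower K Z R]
    [IsDomain Z] [Module.IsTorsionFree Z R] [Module.Finite Z R] (m : Ideal Z) (hm : m ≠ ⊤)
    (t : ℕ) (f : R →ₐ[K] Matrix (Fin t) (Fin t) K)
    (hf : Function.Surjective f) (hker : ∀ x, f x = 0 → x ∈ m • (⊤ : Submodule Z R)) :
    Module.finrank Z R ≤ t * t := by
  classical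
  choose g hg using hf
  let r : Fin t × Fin t → R := fun l => g (Matrix.single l.1 l.2 1)
  let N : Submodule Z R := Submodule.span Z (Set.range r)
  have hN : (⊤ : Submodule Z R) ≤ N ⊔ m • ⊤ := by
    intro x _
    have h1 : ∑ l : Fin t × Fin t, (f x l.1 l.2) • r l ∈ N := by
      refine sum_mem fun l _ => ?_
      rw [← algebraMap_smul Z]
      exact N.smul_mem _ (Submodule.subset_span ⟨l, rfl⟩)
    have h2 : x - ∑ l : Fin t × Fin t, (f x l.1 l.2) • r l ∈ m • (⊤ : Submodule Z R) := by
      apply hker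
      rw [map_sub, map_sum, sub_eq_zero]
      simp only [map_smul, r, hg]
      conv_lhs => rw [Matrix.matrix_eq_sum_single (f x)]
      rw [Fintype.sum_prod_type]
      simp [Matrix.smul_single]
    have := Submodule.add_mem_sup h1 h2
    simpa using this
  obtain ⟨s, hs, hsN⟩ := Submodule.exists_sub_one_mem_and_smul_le_of_fg_of_le_sup
    (Module.Finite.fg_top (R := Z) (M := R)) le_top hN
  have hs0 : s ≠ 0 := by
    rintro rfl
    exact hm ((Ideal.eq_top_iff_one _).2 (by simpa using neg_mem hs))
  have hinj : Function.Injective ((LinearMap.lsmul Z R s).codRestrict N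
      (fun x => hsN (Submodule.smul_mem_pointwise_smul x s ⊤ trivial))) := by
    intro x y hxy
    have := congrArg Subtype.val hxy
    simpa [hs0] using this
  have : Module.Finite Z N := Module.Finite.span_of_finite Z (Set.finite_range r)
  calc Module.finrank Z R ≤ Module.finrank Z N := LinearMap.finrank_le_finrank_of_injective hinj
    _ ≤ Fintype.card (Fin t × Fin t) := finrank_range_le_card r
    _ = t * t := by simp

end Rank

section Quot

variable {K R : Type*} [Field K] [Ring R] [Algebra K R]

def auxMk (K : Type*) {R : Type*} [Field K] [Ring R] [Algebra K R] (I : TwoSidedIdeal R) :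
    R →ₐ[K] I.ringCon.Quotient :=
  { I.ringCon.mk' with commutes' := fun _ => rfl }

lemma auxMk_surj (I : TwoSidedIdeal R) : Function.Surjective (auxMk K I) := by
  intro x
  induction x using Quotient.inductionOn' with
  | h x => exact ⟨x, rfl⟩

lemma auxMk_eq_zero (I : TwoSidedIdeal R) (x : R) : auxMk K I x = 0 ↔ x ∈ I := by
  have : auxMk K I x = I.ringCon.mk' x := rfl
  rw [this, ← TwoSidedIdeal.mem_ker, TwoSidedIdeal.ker_ringCon_mk']

lemma aux_coatom (I : TwoSidedIdeal R) {S : Type*} [Ring S] [IsSimpleRing S] (f : R →+* S)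
    (hf : Function.Surjective f) (hk : ∀ x, f x = 0 ↔ x ∈ I) : IsCoatom I := by
  constructor
  · rintro rfl
    have := (hk 1).2 trivial
    rw [map_one] at this
    exact one_ne_zero this
  · intro J hJ
    obtain ⟨hle, x, hxJ, hxI⟩ := SetLike.lt_iff_le_and_exists.1 hJ
    let J' : TwoSidedIdeal S := TwoSidedIdeal.mk' (f '' (J : Set R)) ⟨0, J.zero_mem, map_zero f⟩
      (by rintro _ _ ⟨a, ha, rfl⟩ ⟨b, hb, rfl⟩; exact ⟨a + b, J.add_mem ha hb, map_add f a b⟩)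
      (by rintro _ ⟨a, ha, rfl⟩; exact ⟨-a, J.neg_mem ha, map_neg f a⟩)
      (by
        rintro y _ ⟨a, ha, rfl⟩
        obtain ⟨b, rfl⟩ := hf y
        exact ⟨b * a, J.mul_mem_left _ _ ha, map_mul f b a⟩)
      (by
        rintro _ y ⟨a, ha, rfl⟩
        obtain ⟨b, rfl⟩ := hf y
        exact ⟨a * b, J.mul_mem_right _ _ ha, map_mul f a b⟩)
    have h1 : (1 : S) ∈ J' := by
      apply IsSimpleRing.one_mem_of_ne_zero_mem J' (x := f x)
      · rw [Ne, hk]; exact hxI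
      · exact (TwoSidedIdeal.mem_mk' _ _ _ _ _ _ _).2 ⟨x, hxJ, rfl⟩
    obtain ⟨y, hy, hy1⟩ := (TwoSidedIdeal.mem_mk' _ _ _ _ _ _ _).1 h1
    rw [← TwoSidedIdeal.one_mem_iff]
    have : (1 : R) - y ∈ J := hle ((hk _).1 (by rw [map_sub, map_one, hy1, sub_self]))
    simpa using J.add_mem this hy

lemma aux_simple (K : Type*) {R : Type*} [Field K] [Ring R] [Algebra K R] (I : TwoSidedIdeal R) (h : IsCoatom I) : IsSimpleRing I.ringCon.Quotient := by
  have hnt : Nontrivial I.ringCon.Quotient := by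
    refine ⟨1, 0, fun h1 => h.1 ?_⟩
    rw [← TwoSidedIdeal.one_mem_iff, ← auxMk_eq_zero (K := K), map_one, h1]
  refine IsSimpleRing.of_eq_bot_or_eq_top fun J => ?_
  have hle : I ≤ TwoSidedIdeal.comap (auxMk K I) J := by
    intro x hx
    rw [TwoSidedIdeal.mem_comap, (auxMk_eq_zero I x).2 hx]
    exact J.zero_mem
  rcases hle.eq_or_lt with heq | hlt
  · left
    apply TwoSidedIdeal.ext
    intro x
    obtain ⟨y, rfl⟩ := auxMk_surj (K := K) I x
    rw [TwoSidedIdeal.mem_bot, auxMk_eq_zero, ← TwoSidedIdeal.mem_comap, ← heq]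
  · right
    have := h.2 _ hlt
    rw [← TwoSidedIdeal.one_mem_iff, TwoSidedIdeal.mem_comap, map_one,
      TwoSidedIdeal.one_mem_iff] at this
    exact this

lemma aux_semisimple (I : TwoSidedIdeal R) {S : Type*} [Ring S] [Algebra K S] [IsSemisimpleRing S]
    (f : R →ₐ[K] S) (hf : Function.Surjective f) (hk : ∀ x, f x = 0 ↔ x ∈ I) :
    IsSemisimpleRing I.ringCon.Quotient := by
  have hle : I.ringCon ≤ RingCon.ker f.toRingHom := by
    intro x y hxy
    rw [TwoSidedIdeal.rel_iff, ← hk, map_sub, sub_eq_zero] at hxy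
    exact hxy
  let g : I.ringCon.Quotient →+* S := RingCon.lift I.ringCon f.toRingHom hle
  have hg : ∀ x, g (auxMk K I x) = f x := fun x => rfl
  have hbij : Function.Bijective g := by
    constructor
    · rw [injective_iff_map_eq_zero]
      intro x hx
      obtain ⟨y, rfl⟩ := auxMk_surj (K := K) I x
      rwa [auxMk_eq_zero, ← hk]
    · intro s
      obtain ⟨y, rfl⟩ := hf s
      exact ⟨auxMk K I y, rfl⟩
  exact (RingEquiv.ofBijective g hbij).symm.isSemisimpleRing

variable {Z : Type*} [CommRing Z] [Algebra Z R] [Algebra K Z] [IsScalarTower K Z R]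

lemma aux_finite [Module.Finite Z R] (m : Ideal Z)
    (hres : ∀ z : Z, ∃ c : K, z - algebraMap K Z c ∈ m)
    (I : TwoSidedIdeal R) (hI : ∀ x, x ∈ I ↔ x ∈ m • (⊤ : Submodule Z R)) :
    Module.Finite K I.ringCon.Quotient := by
  classical
  obtain ⟨s, hs⟩ := Module.Finite.fg_top (R := Z) (M := R)
  refine ⟨⟨s.image (auxMk K I), ?_⟩⟩
  rw [eq_top_iff]
  intro x _
  obtain ⟨y, rfl⟩ := auxMk_surj (K := K) I x
  have hy : y ∈ Submodule.span Z (s : Set R) := by rw [hs]; trivial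
  induction hy using Submodule.span_induction with
  | mem w hw => exact Submodule.subset_span (by simpa using ⟨w, hw, rfl⟩)
  | zero => rw [map_zero]; exact zero_mem _
  | add a b _ _ ha hb => rw [map_add]; exact add_mem (ha trivial) (hb trivial)
  | smul z b _ hb =>
    obtain ⟨c, hc⟩ := aux_smul_mem_span K m hres z b
    rw [← hI, ← auxMk_eq_zero (K := K), map_sub, sub_eq_zero] at hc
    rw [hc, map_smul]
    exact Submodule.smul_mem _ _ (hb trivial)

lemma aux_matrix_of_coatom [IsAlgClosed K] [Module.Finite Z R] (m : Ideal Z)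
    (hres : ∀ z : Z, ∃ c : K, z - algebraMap K Z c ∈ m)
    (I : TwoSidedIdeal R) (hI : ∀ x, x ∈ I ↔ x ∈ m • (⊤ : Submodule Z R)) (h : IsCoatom I) :
    ∃ t : ℕ, 0 < t ∧ ∃ f : R →ₐ[K] Matrix (Fin t) (Fin t) K,
        Function.Surjective f ∧ ∀ x : R, f x = 0 ↔ x ∈ I := by
  have := aux_finite m hres I hI
  have := aux_simple K I h
  obtain ⟨t, ht, ⟨e⟩⟩ := IsSimpleRing.exists_algEquiv_matrix_of_isAlgClosed K I.ringCon.Quotient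
  refine ⟨t, Nat.pos_of_ne_zero ht.out, e.toAlgHom.comp (auxMk K I),
    e.surjective.comp (auxMk_surj (K := K) I), fun x => ?_⟩
  rw [← auxMk_eq_zero (K := K)]
  exact map_eq_zero_iff e e.injective

lemma aux_matrix_of_semisimple [IsAlgClosed K] [Module.Finite Z R] [IsNoetherianRing Z]
    (hinj : Function.Injective (algebraMap Z R))
    (hZ : ∀ x : R, (∀ y, x * y = y * x) → ∃ z : Z, algebraMap Z R z = x)
    (m : Ideal Z) (hm : m ≠ ⊤)
    (hres : ∀ z : Z, ∃ c : K, z - algebraMap K Z c ∈ m)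
    (I : TwoSidedIdeal R) (hI : ∀ x, x ∈ I ↔ x ∈ m • (⊤ : Submodule Z R))
    (h : IsSemisimpleRing I.ringCon.Quotient) :
    ∃ t : ℕ, 0 < t ∧ ∃ f : R →ₐ[K] Matrix (Fin t) (Fin t) K,
        Function.Surjective f ∧ ∀ x : R, f x = 0 ↔ x ∈ I := by
  classical
  have := aux_finite m hres I hI
  obtain ⟨q, d, hd, ⟨e⟩⟩ :=
    IsSemisimpleRing.exists_algEquiv_pi_matrix_of_isAlgClosed K I.ringCon.Quotient
  let F : R →ₐ[K] (Π i, Matrix (Fin (d i)) (Fin (d i)) K) := e.toAlgHom.comp (auxMk K I)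
  have hF : Function.Surjective F := e.surjective.comp (auxMk_surj (K := K) I)
  have hFk : ∀ x, F x = 0 ↔ x ∈ I := fun x => by
    rw [← auxMk_eq_zero (K := K)]
    exact map_eq_zero_iff e e.injective
  have hq : 0 < q := by
    rcases Nat.eq_zero_or_pos q with rfl | hq
    · exfalso
      apply aux_one_notMem hinj m hm
      rw [← hI, ← hFk]
      exact funext fun i => i.elim0
    · exact hq
  let i₀ : Fin q := ⟨0, hq⟩
  have hall : ∀ i, i = i₀ := by
    intro i
    by_contra hne
    obtain ⟨x, hx⟩ := hF (Pi.single i 1)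
    obtain ⟨z, hz⟩ := aux_idem_central hZ m x
      (by
        rw [← hI, ← hFk, map_sub, map_mul, hx, ← Pi.single_mul, mul_one, sub_self])
      (by
        intro y
        rw [← hI, ← hFk, map_sub, map_mul, map_mul, hx, sub_eq_zero]
        funext j
        by_cases hj : j = i
        · subst hj; simp
        · simp [hj])
    obtain ⟨c, hc⟩ := hres z
    have hz2 : x - algebraMap K R c ∈ m • (⊤ : Submodule Z R) := by
      have h1 : algebraMap Z R (z - algebraMap K Z c) ∈ m • (⊤ : Submodule Z R) := by
        rw [Algebra.algebraMap_eq_smul_one]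
        exact Submodule.smul_mem_smul hc trivial
      have h2 := add_mem hz h1
      rw [map_sub, ← IsScalarTower.algebraMap_apply K Z R] at h2
      simpa using h2
    rw [← hI, ← hFk, map_sub, hx, sub_eq_zero, AlgHom.commutes] at hz2
    have h0 := congrFun hz2 i₀
    have h1 := congrFun hz2 i
    rw [Pi.single_eq_of_ne (Ne.symm hne), Pi.algebraMap_apply] at h0
    rw [Pi.single_eq_same, Pi.algebraMap_apply] at h1
    have hc0 : c = 0 := by
      have hnz := hd i₀
      have : Nonempty (Fin (d i₀)) := ⟨0⟩
      exact (map_eq_zero_iff _ (algebraMap K (Matrix (Fin (d i₀)) (Fin (d i₀)) K)).injective).1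
        h0.symm
    subst hc0
    have hnz := hd i
    have : Nonempty (Fin (d i)) := ⟨0⟩
    rw [map_zero] at h1
    exact one_ne_zero h1
  refine ⟨d i₀, Nat.pos_of_ne_zero (hd i₀).out, (Pi.evalAlgHom K _ i₀).comp F,
    fun y => ?_, fun x => ?_⟩
  · obtain ⟨x, hx⟩ := hF (Pi.single i₀ y)
    exact ⟨x, by simp [hx]⟩
  · rw [← hFk]
    constructor
    · intro hx
      funext i
      rw [hall i]
      exact hx
    · intro hx
      simp [hx]

end Quot

theorem aux_main {K R Z : Type u} [Field K] [IsAlgClosed K] [Ring R] [Algebra K R]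
    [Algebra.FiniteType K R] [CommRing Z] [Algebra K Z] [Algebra Z R]
    (htower : IsScalarTower K Z R) (hfin : Module.Finite Z R)
    (n : ℕ) (hn : 0 < n)
    (hPI : Module.finrank (FractionRing Z) ((FractionRing Z) ⊗[Z] R) = n ^ 2)
    (m : Ideal Z) (hm : m.IsMaximal)
    (hinj : Function.Injective (algebraMap Z R))
    (hZ : ∀ x : R, (∀ y, x * y = y * x) → ∃ z : Z, algebraMap Z R z = x)
    (hsmz : ∀ (z : Z) (x : R), algebraMap Z R z * x = 0 → z = 0 ∨ x = 0)
    (I : TwoSidedIdeal R)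
    (hIs : I = TwoSidedIdeal.span ((fun z : Z => algebraMap Z R z) '' (m : Set Z))) :
    (IsSemisimpleRing I.ringCon.Quotient ↔ IsCoatom I) ∧
    (IsCoatom I ↔
      ∃ f : R →ₐ[K] Matrix (Fin n) (Fin n) K,
        Function.Surjective f ∧ ∀ x : R, f x = 0 ↔ x ∈ I) := by
  have hsm : ∀ (z : Z) (x : R), z • x = algebraMap Z R z * x :=
    fun z x => Algebra.smul_def z x
  have hI : ∀ x, x ∈ I ↔
      x ∈ m • (⊤ : Submodule Z R) := by
    intro x
    constructor
    · intro hx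
      let J : TwoSidedIdeal R := TwoSidedIdeal.mk'
        (m • (⊤ : Submodule Z R) : Submodule Z R)
        (zero_mem _) (fun ha hb => add_mem ha hb) (fun ha => neg_mem ha)
        (fun ha => aux_mul_mem_left _ _ ha) (fun ha => aux_mul_mem_right _ _ ha)
      have hJ : I ≤ J := by
        rw [hIs, TwoSidedIdeal.span_le]
        rintro _ ⟨z, hz, rfl⟩
        refine (TwoSidedIdeal.mem_mk' _ _ _ _ _ _ _).2 ?_
        have : z • (1 : R) ∈ m • (⊤ : Submodule Z R) :=
          Submodule.smul_mem_smul hz trivial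
        rw [hsm, mul_one] at this
        exact this
      exact (TwoSidedIdeal.mem_mk' _ _ _ _ _ _ _).1 (hJ hx)
    · intro hx
      refine Submodule.smul_induction_on hx (fun a ha u _ => ?_) (fun u v hu hv => ?_)
      · rw [hsm]
        exact TwoSidedIdeal.mul_mem_right _ _ _ (hIs ▸ TwoSidedIdeal.subset_span ⟨a, ha, rfl⟩)
      · exact TwoSidedIdeal.add_mem _ hu hv
  have hft : Algebra.FiniteType K Z := aux_artinTate K hinj
  have hnoeth : IsNoetherianRing Z :=
    Algebra.FiniteType.isNoetherianRing K _
  have hres := aux_residue K m hm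
  have hnt : Nontrivial Z := by
    by_contra hh
    rw [not_nontrivial_iff_subsingleton] at hh
    exact hm.ne_top (Subsingleton.elim _ _)
  have hdom : IsDomain Z := by
    have : NoZeroDivisors Z := ⟨fun {a b} hab => by
      rcases hsmz a (algebraMap Z R b) (by rw [← map_mul, hab, map_zero]) with h | h
      · exact Or.inl h
      · exact Or.inr (hinj (by rw [h, map_zero]))⟩
    exact NoZeroDivisors.to_isDomain _
  have htf : Module.IsTorsionFree Z R :=
    Module.IsTorsionFree.of_smul_eq_zero fun z x h => hsmz z x (by rwa [← hsm])
  have hrank : Module.finrank Z R = n ^ 2 := by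
    rw [← hPI]
    exact (IsBaseChange.finrank_eq (TensorProduct.isBaseChange Z R
      (FractionRing Z))).symm
  have key : (∃ t : ℕ, 0 < t ∧ ∃ f : R →ₐ[K] Matrix (Fin t) (Fin t) K,
        Function.Surjective f ∧ ∀ x : R, f x = 0 ↔ x ∈ I) →
      ∃ f : R →ₐ[K] Matrix (Fin n) (Fin n) K,
        Function.Surjective f ∧ ∀ x : R, f x = 0 ↔ x ∈ I := by
    rintro ⟨t, ht, f, hf, hk⟩
    have h1 := aux_capelli (Z := Z) t ht f.toRingHom hf
    have h2 := aux_generic_le m hm.ne_top t f hf (fun x hx => (hI x).1 ((hk x).1 hx))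
    have : t = n := by
      rw [hrank] at h1 h2
      have h3 : t ^ 2 = n ^ 2 := by rw [sq t]; exact le_antisymm h1 h2
      exact Nat.pow_left_injective two_ne_zero h3
    subst this
    exact ⟨f, hf, hk⟩
  have hne : Nonempty (Fin n) := ⟨⟨0, hn⟩⟩
  have h31 : (∃ f : R →ₐ[K] Matrix (Fin n) (Fin n) K,
        Function.Surjective f ∧ ∀ x : R, f x = 0 ↔ x ∈ I) →
      IsSemisimpleRing I.ringCon.Quotient := fun ⟨f, hf, hk⟩ =>
    aux_semisimple _ f hf hk
  have h32 : (∃ f : R →ₐ[K] Matrix (Fin n) (Fin n) K,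
        Function.Surjective f ∧ ∀ x : R, f x = 0 ↔ x ∈ I) →
      IsCoatom I := fun ⟨f, hf, hk⟩ =>
    aux_coatom _ f.toRingHom hf hk
  have h23 := fun h => key (aux_matrix_of_coatom m hres _ hI h)
  have h13 := fun h => key (aux_matrix_of_semisimple hinj hZ m hm.ne_top hres _ hI h)
  exact ⟨⟨fun h => h32 (h13 h), fun h => h31 (h23 h)⟩, h23, h32⟩

/-- **Part of Theorem 3.2(b) of Brown–Yakimov**: let `R` be a prime affine algebra over an
algebraically closed field `K`, module-finite over its center `Z(R)`, of PI degree `n`, and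
let `m` be a maximal ideal of `Z(R)`. The following are equivalent: (i) `R/mR` is a
semisimple ring; (ii) `mR` is a maximal two-sided ideal of `R`; (iii) `R/mR ≅ M_n(K)`, i.e.
there is a surjective `K`-algebra map `R → M_n(K)` with kernel `mR`. -/
theorem semisimple_iff_maximal_iff_matrix
    {K R : Type u} [Field K] [IsAlgClosed K] [Ring R] [Algebra K R]
    [Algebra.FiniteType K R] (hprime : IsPrimeRing R)
    [Module.Finite (Subalgebra.center K R) R]
    (n : ℕ) (hn : 0 < n)
    (hPI : Module.finrank (FractionRing (Subalgebra.center K R))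
        ((FractionRing (Subalgebra.center K R)) ⊗[Subalgebra.center K R] R) = n ^ 2)
    (m : Ideal (Subalgebra.center K R)) (hm : m.IsMaximal) :
    (IsSemisimpleRing (centralExtension m).ringCon.Quotient ↔ IsCoatom (centralExtension m)) ∧
    (IsCoatom (centralExtension m) ↔
      ∃ f : R →ₐ[K] Matrix (Fin n) (Fin n) K,
        Function.Surjective f ∧ ∀ x : R, f x = 0 ↔ x ∈ centralExtension m) := by
  refine aux_main (Z := Subalgebra.center K R) (IsScalarTower.of_algebraMap_eq fun _ => rfl)
    (by assumption) n hn (by exact hPI) m hm Subtype.val_injective ?_ ?_ _ rfl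
  · exact fun x hx => ⟨⟨x, Subalgebra.mem_center_iff.2 fun b => (hx b).symm⟩, rfl⟩
  · intro z x h
    replace h : (z : R) * x = 0 := h
    rcases hprime z x (fun r => by
      rw [← Subalgebra.mem_center_iff.1 z.2 r, mul_assoc, h, mul_zero]) with h | h
    · exact Or.inl (Subtype.ext h)
    · exact Or.inr h
end
end

section
/- Let K be an algebraically closed field, B a finite-dimensional K-algebra, V_1,…,V_j pairwise non-isomorphic simple B-modules, and s_1,…,s_j nonzero elements of K. Define tr : B → K by tr = s_1 tr_{V_1} + ⋯ + s_j tr_{V_j}. Then the kernel L = {b ∈ B : tr(bx) = 0 for all x ∈ B} of the associated trace form equals the intersection ∩_{i=1}^j Ann_B(V_i) of the annihilators; in particular, the Jacobson radical J(B) is contained in L. -/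
open TensorProduct

set_option synthInstance.maxHeartbeats 1600000
set_option maxHeartbeats 3200000

noncomputable section

universe u v

/-- Density for a finite family of pairwise non-isomorphic simple modules. -/
theorem density_family_aux {K B : Type u} [Field K] [IsAlgClosed K] [Ring B] [Algebra K B]
    {n : ℕ} (W : Fin n → Type u) [∀ i, AddCommGroup (W i)] [∀ i, Module B (W i)]
    [∀ i, Module K (W i)] [∀ i, IsScalarTower K B (W i)] [∀ i, FiniteDimensional K (W i)]
    [∀ i, IsSimpleModule B (W i)]
    (hnoniso : ∀ i k, i ≠ k → ¬ Nonempty (W i ≃ₗ[B] W k))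
    (i : Fin n) (φ : W i →ₗ[K] W i) :
    ∃ r : B, (∀ v : W i, r • v = φ v) ∧ ∀ k, k ≠ i → ∀ v : W k, r • v = 0 := by
  classical
  have key : ∀ g : Module.End B (∀ i, W i), ∀ b, ∃ c : K, ∀ m, (g m) b = c • m b := by
    intro g b
    let h : ∀ a, W a →ₗ[B] W b := fun a =>
      (LinearMap.proj b).comp (g.comp (LinearMap.single B W a))
    obtain ⟨c, hc⟩ :=
      (IsSimpleModule.algebraMap_end_bijective_of_isAlgClosed (A := B) (V := W b) K).2 (h b)
    refine ⟨c, fun m => ?_⟩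
    have h0 : ∀ a, a ≠ b → h a = 0 := by
      intro a hab
      rcases (h a).bijective_or_eq_zero with hb | hb
      · exact (hnoniso a b hab ⟨LinearEquiv.ofBijective _ hb⟩).elim
      · exact hb
    have hm : g m b = ∑ a, h a (m a) := by
      conv_lhs => rw [← Finset.univ_sum_single m]
      rw [map_sum, Finset.sum_apply]
      rfl
    rw [hm, Finset.sum_eq_single b]
    · rw [← hc]; rfl
    · intro a _ hab
      rw [h0 a hab]; rfl
    · intro hb; exact (hb (Finset.mem_univ b)).elim
  let fK : (∀ i, W i) →ₗ[K] (∀ i, W i) :=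
    (LinearMap.single K W i).comp (φ.comp (LinearMap.proj i))
  have hfK : ∀ m, fK m = Pi.single i (φ (m i)) := fun m => rfl
  let f : Module.End (Module.End B (∀ i, W i)) (∀ i, W i) :=
    { toFun := fK
      map_add' := fun x y => map_add fK x y
      map_smul' := by
        intro g m
        change fK (g m) = g (fK m)
        funext b
        obtain ⟨c, hc⟩ := key g b
        rw [hc, hfK, hfK]
        by_cases hb : b = i
        · subst hb
          rw [Pi.single_eq_same, Pi.single_eq_same, hc, map_smul]
        · rw [Pi.single_eq_of_ne hb, Pi.single_eq_of_ne hb, smul_zero] }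
  obtain ⟨t, ht⟩ := Module.Finite.fg_top (R := K) (M := ∀ i, W i)
  obtain ⟨r, hr⟩ := jacobson_density (R := B) f t
  have hall : ∀ m : (∀ i, W i), fK m = r • m := by
    intro m
    have hm : m ∈ Submodule.span K (t : Set (∀ i, W i)) := by rw [ht]; trivial
    induction hm using Submodule.span_induction with
    | mem m hm => exact hr m hm
    | zero => simp
    | add x y _ _ hx hy => rw [map_add, hx, hy, smul_add]
    | smul c x _ hx => rw [map_smul, hx, smul_comm]
  refine ⟨r, fun v => ?_, fun k hk v => ?_⟩
  · have := congrFun (hall (Pi.single i v)) i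
    rw [hfK, Pi.smul_apply, Pi.single_eq_same, Pi.single_eq_same] at this
    exact this.symm
  · have := congrFun (hall (Pi.single k v)) k
    rw [hfK, Pi.smul_apply, Pi.single_eq_same, Pi.single_eq_of_ne hk] at this
    exact this.symm

theorem traceOver_eq_aux (K : Type v) [Field K] (R : Type u) [Ring R] [Algebra K R]
    (W : Type u) [AddCommGroup W] [Module R W] (a : R) :
    letI : Module K W := Module.compHom W (algebraMap K R)
    ∀ f : W →ₗ[K] W, (∀ w, f w = a • w) → traceOver K R W a = LinearMap.trace K W f := by
  intro f hf
  let _ : Module K W := Module.compHom W (algebraMap K R)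
  unfold traceOver
  congr 1
  ext w
  exact (hf w).symm

/-- **Lemma 3.3(b) of Brown–Yakimov**: let `B` be a finite-dimensional algebra over an
algebraically closed field `K`, let `V 1, …, V j` be pairwise non-isomorphic simple
`B`-modules and `s i` nonzero scalars, and set `tr = ∑ i, s i • tr_{V i}`. Then the kernel
`L = {b | tr (b x) = 0 ∀ x}` of the associated trace form equals `⋂ i Ann_B (V i)`; in
particular the Jacobson radical of `B` is contained in `L`. -/
theorem trace_form_kernel_eq_inter_annihilators
    {K B : Type u} [Field K] [IsAlgClosed K] [Ring B] [Algebra K B]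
    [FiniteDimensional K B]
    (j : ℕ) (V : Fin j → ModRep B)
    (hsimple : ∀ i, IsSimpleModule B (V i).carrier)
    (hnoniso : ∀ i k, i ≠ k → ¬ Nonempty ((V i).carrier ≃ₗ[B] (V k).carrier))
    (s : Fin j → K) (hs : ∀ i, s i ≠ 0)
    (tr : B → K) (htr : ∀ b : B, tr b = ∑ i, s i * repTrace K (V i) b) :
    {b : B | ∀ x : B, tr (b * x) = 0} =
      ⋂ i, {b : B | ∀ v : (V i).carrier, b • v = 0} ∧
    ∀ b ∈ (⊥ : Ideal B).jacobson, ∀ x : B, tr (b * x) = 0 := by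
  letI instK : ∀ i, Module K (V i).carrier := fun i =>
    Module.compHom (V i).carrier (algebraMap K B)
  haveI instT : ∀ i, IsScalarTower K B (V i).carrier := fun i =>
    ⟨fun c b w => by
      rw [Algebra.smul_def, mul_smul]; rfl⟩
  haveI instF : ∀ i, FiniteDimensional K (V i).carrier := fun i =>
    haveI : Module.Finite B (V i).carrier := inferInstance
    Module.Finite.trans B (V i).carrier
  have hsup : ∀ b : B, (∀ i, ∀ v : (V i).carrier, b • v = 0) → ∀ x, tr (b * x) = 0 := by
    intro b hb x
    rw [htr]
    refine Finset.sum_eq_zero fun i _ => ?_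
    have : repTrace K (V i) (b * x) = LinearMap.trace K (V i).carrier 0 :=
      traceOver_eq_aux K B (V i).carrier (b * x) 0 fun w => by
        rw [mul_smul, hb i]; rfl
    rw [this, map_zero, mul_zero]
  refine ⟨?_, ?_⟩
  · ext b
    simp only [Set.mem_ofPred_eq, Set.mem_iInter]
    refine ⟨fun hb i v => ?_, fun hb => hsup b hb⟩
    rw [← Module.forall_dual_apply_eq_zero_iff K]
    intro f
    obtain ⟨r, hr1, hr2⟩ := density_family_aux (K := K) (B := B)
      (fun i => (V i).carrier) hnoniso i (f.smulRight v)
    have h1 := hb r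
    rw [htr, Finset.sum_eq_single i] at h1
    · have : repTrace K (V i) (b * r) =
          LinearMap.trace K (V i).carrier (f.smulRight (b • v)) :=
        traceOver_eq_aux K B (V i).carrier (b * r) _ fun w => by
          rw [mul_smul, hr1 w]
          change f w • b • v = b • (f w • v)
          rw [smul_comm]
      rw [this, LinearMap.trace_smulRight] at h1
      exact (mul_eq_zero.mp h1).resolve_left (hs i)
    · intro k _ hk
      have : repTrace K (V k) (b * r) = LinearMap.trace K (V k).carrier 0 :=
        traceOver_eq_aux K B (V k).carrier (b * r) 0 fun w => by
          rw [mul_smul, hr2 k hk, smul_zero]; rfl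
      rw [this, map_zero, mul_zero]
    · intro hi; exact (hi (Finset.mem_univ i)).elim
  · intro b hb
    refine hsup b fun i v => ?_
    rw [Ideal.jacobson_bot] at hb
    exact Module.mem_annihilator.mp
      (IsSemisimpleModule.jacobson_le_annihilator B (V i).carrier hb) v
end
end

section
/- Let R be an algebra over a field K, C a central subalgebra of K-algebra R over which R is a finite module, and tr : R → C a trace-like map. Let m be a positive integer and w_1,…,w_m ∈ R. Suppose there exist z_1,…,z_m ∈ C, at least one of which is a regular element (non-zero-divisor) of C, with Σ_{i=1}^m z_i w_i = 0. Then for all u_1,…,u_m ∈ R, det([tr(w_i u_j)]_{i,j=1}^m) = 0. -/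
open TensorProduct

set_option synthInstance.maxHeartbeats 1600000
set_option maxHeartbeats 3200000

noncomputable section

universe u v

/-- **Lemma 2.3(b) of Brown–Yakimov**: let `R` be an algebra over a field `K`, `C` a central
subalgebra over which `R` is a finite module, and `tr : R → C` a trace-like map. If
`w₁, …, w_m ∈ R` satisfy a `C`-linear relation `∑ zᵢ wᵢ = 0` in which some coefficient `z_k`
is a regular element (non-zero-divisor) of `C`, then `det [tr (wᵢ uⱼ)] = 0` for all
`u₁, …, u_m ∈ R`. -/
theorem det_trace_matrix_eq_zero_of_relation
    {K C R : Type u} [Field K] [CommRing C] [Ring R]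
    [Algebra K C] [Algebra K R] [Algebra C R] [IsScalarTower K C R]
    (hinj : Function.Injective (algebraMap C R))
    [Module.Finite C R]
    (tr : R →ₗ[C] C) (hcyc : ∀ x y : R, tr (x * y) = tr (y * x))
    (m : ℕ) (hm : 0 < m) (w : Fin m → R) (z : Fin m → C)
    (k : Fin m) (hk : z k ∈ nonZeroDivisors C)
    (hrel : ∑ i, z i • w i = 0) :
    ∀ u : Fin m → R, Matrix.det (Matrix.of fun i j => tr (w i * u j)) = 0 := by
  intro u
  set A : Matrix (Fin m) (Fin m) C := Matrix.of fun i j => tr (w i * u j) with hA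
  have h := Matrix.det_updateRow_sum A k z
  have h0 : (∑ i, z i • A i) = 0 := by
    funext j
    have h1 : tr ((∑ i, z i • w i) * u j) = 0 := by rw [hrel]; simp
    rw [Finset.sum_mul, map_sum] at h1
    simpa [hA, Finset.sum_apply] using h1
  have h2 : (A.updateRow k (∑ i, z i • A i)).det = 0 := by
    rw [h0]
    exact Matrix.det_eq_zero_of_row_eq_zero k (by simp)
  have h3 : z k * A.det = 0 := by
    rw [← smul_eq_mul, ← h]
    exact h2
  exact (mul_left_mem_nonZeroDivisors_eq_zero_iff hk).mp h3
end
end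

section
/- Let R be a Cayley–Hamilton algebra of degree n with trace tr : R → C over an algebraically closed field K of characteristic 0. Then the zero sets of the n²-discriminant ideal and the modified n²-discriminant ideal of R over C coincide and equal the complement of the Azumaya locus: V(D_{n²}(R/C,tr)) = V(MD_{n²}(R/C,tr)) = maxSpec C \ A(R), where A(R) = { m ∈ maxSpec C : R has an irreducible representation of dimension n annihilated by m }. -/
open TensorProduct

set_option synthInstance.maxHeartbeats 1600000
set_option maxHeartbeats 3200000

noncomputable section

universe u v

section
open Polynomial

lemma vander_lt {K C M : Type*} [Field K] [CharZero K] [CommRing C] [Algebra K C]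
    [AddCommGroup M] [Module C M] (J : Submodule C M) (N : ℕ) (p : ℕ → M)
    (h : ∀ t < N, ∑ i ∈ Finset.range N, (t : C) ^ i • p i ∈ J) : ∀ i < N, p i ∈ J := by
  intro i hi
  let V : Matrix (Fin N) (Fin N) K := Matrix.vandermonde (fun k : Fin N => ((k : ℕ) : K))
  have hV : V.det ≠ 0 := by
    rw [Matrix.det_vandermonde_ne_zero_iff]
    intro a b hab
    exact Fin.ext (by simpa using hab)
  have h1 : V⁻¹ * V = 1 := Matrix.nonsing_inv_mul _ (isUnit_iff_ne_zero.mpr hV)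
  have key : ∑ t : Fin N, algebraMap K C (V⁻¹ ⟨i, hi⟩ t) •
      (∑ j ∈ Finset.range N, ((t : ℕ) : C) ^ j • p j) = p i := by
    simp_rw [Finset.sum_range, Finset.smul_sum, smul_smul]
    rw [Finset.sum_comm]
    simp_rw [← Finset.sum_smul]
    have : ∀ j : Fin N, ∑ t : Fin N, algebraMap K C (V⁻¹ ⟨i, hi⟩ t) * ((t : ℕ) : C) ^ (j : ℕ)
        = if (⟨i, hi⟩ : Fin N) = j then 1 else 0 := by
      intro j
      have h2 := congrFun (congrFun h1 ⟨i, hi⟩) j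
      rw [Matrix.mul_apply, Matrix.one_apply] at h2
      have h3 := congrArg (algebraMap K C) h2
      rw [map_sum] at h3
      simpa [V, Matrix.vandermonde_apply, apply_ite (algebraMap K C)] using h3
    simp_rw [this]
    simp
  rw [← key]
  exact Submodule.sum_mem _ fun t _ => J.smul_mem _ (h t t.2)

lemma vander_aux {K C M : Type*} [Field K] [CharZero K] [CommRing C] [Algebra K C]
    [AddCommGroup M] [Module C M] (J : Submodule C M) (N : ℕ) (p : ℕ → M)
    (h : ∀ t : ℕ, ∑ i ∈ Finset.range N, (t : C) ^ i • p i ∈ J) : ∀ i < N, p i ∈ J :=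
  vander_lt (K := K) J N p (fun t _ => h t)

lemma lin_expand {C G : Type*} [CommRing C] [Ring G] [Algebra C G] (a b : G) (n : ℕ) :
    ∃ p : ℕ → G, p 1 = ∑ i ∈ Finset.range n, a ^ i * b * a ^ (n - 1 - i) ∧ p 0 = a ^ n ∧
      (∀ i, n < i → p i = 0) ∧
      ∀ t : ℕ, (a + (t : C) • b) ^ n = ∑ i ∈ Finset.range (n + 2), (t : C) ^ i • p i := by
  induction n with
  | zero =>
    refine ⟨fun i => if i = 0 then 1 else 0, by simp, by simp, ?_, ?_⟩
    · intro i hi; simp; omega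
    · intro t; simp
  | succ n ih =>
    obtain ⟨p, h1, h0, hz, hp⟩ := ih
    refine ⟨fun i => p i * a + (if i = 0 then 0 else p (i - 1) * b), ?_, ?_, ?_, ?_⟩
    · simp only [one_ne_zero, if_false, Nat.sub_self, h0, h1, Finset.sum_range_succ]
      simp only [Nat.add_sub_cancel, Nat.sub_self, pow_zero, mul_one, Finset.sum_mul]
      congr 1
      refine Finset.sum_congr rfl fun i hi => ?_
      have : n - i = (n - 1 - i) + 1 := by have := Finset.mem_range.mp hi; omega
      rw [this, pow_succ, mul_assoc (a ^ i * b)]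
    · simp [h0, pow_succ]
    · intro i hi
      have : i ≠ 0 := by omega
      simp [this, hz i (by omega), hz (i - 1) (by omega)]
    · intro t
      rw [pow_succ, hp t, mul_add]
      simp only [smul_add, Finset.sum_add_distrib]
      congr 1
      · rw [Finset.sum_range_succ _ (n + 2), hz (n + 2) (by omega)]
        simp [Finset.sum_mul]
      · rw [Finset.sum_range_succ' _ (n + 2)]
        simp [Finset.sum_mul, Finset.smul_sum, smul_smul, pow_succ']
        
lemma lin_mem {K C G : Type*} [Field K] [CharZero K] [CommRing C] [Algebra K C]
    [Ring G] [Algebra C G] (P J : Submodule C G) (n : ℕ) 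
    (h : ∀ a ∈ P, a ^ n ∈ J) (a b : G) (ha : a ∈ P) (hb : b ∈ P) :
    ∑ i ∈ Finset.range n, a ^ i * b * a ^ (n - 1 - i) ∈ J := by
  obtain ⟨p, h1, h0, hz, hp⟩ := lin_expand (C := C) a b n
  rw [← h1]
  refine vander_aux (K := K) J (n + 2) p ?_ 1 (by omega)
  intro t
  rw [← hp t]
  exact h _ (P.add_mem ha (P.smul_mem _ hb))

lemma pow_mem_of {C G : Type*} [CommRing C] [Ring G] [Algebra C G] (P : Submodule C G)
    (hPP : P * P ≤ P) {a : G} (ha : a ∈ P) : ∀ k, 1 ≤ k → a ^ k ∈ P := by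
  intro k hk
  induction k, hk using Nat.le_induction with
  | base => simpa
  | succ k _ ih => rw [pow_succ]; exact hPP (Submodule.mul_mem_mul ih ha)

lemma higman_id {K C G : Type*} [Field K] [CharZero K] [CommRing C] [Algebra K C]
    [Ring G] [Algebra C G] (P J : Submodule C G) (hPP : P * P ≤ P) (hPJ : P * J ≤ J)
    (hJP : J * P ≤ J) (n : ℕ) 
    (h : ∀ a ∈ P, a ^ (n + 1) ∈ J) (x y z : G) (hx : x ∈ P) (hy : y ∈ P) (hz : z ∈ P) :
    x ^ n * z * y ^ n ∈ J := by
  let f : G → G → G := fun a b => ∑ i ∈ Finset.range (n + 1), a ^ i * b * a ^ (n - i)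
  have hf : ∀ a ∈ P, ∀ b ∈ P, f a b ∈ J := fun a ha b hb => by
    simpa using lin_mem (K := K) P J (n + 1) h a b ha hb
  have hJpow : ∀ u ∈ J, ∀ k, u * y ^ k ∈ J := by
    intro u hu k
    rcases Nat.eq_zero_or_pos k with rfl | hk
    · simpa
    · exact hJP (Submodule.mul_mem_mul hu (pow_mem_of P hPP hy k hk))
  have hpowJ : ∀ u ∈ J, ∀ k, x ^ k * u ∈ J := by
    intro u hu k
    rcases Nat.eq_zero_or_pos k with rfl | hk
    · simpa
    · exact hPJ (Submodule.mul_mem_mul (pow_mem_of P hPP hx k hk) hu)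
  have hzy : ∀ k, z * y ^ k ∈ P := by
    intro k
    rcases Nat.eq_zero_or_pos k with rfl | hk
    · simpa
    · exact hPP (Submodule.mul_mem_mul hz (pow_mem_of P hPP hy k hk))
  have e1 : ∑ j ∈ Finset.range (n + 1), f x (z * y ^ j) * y ^ (n - j) ∈ J :=
    Submodule.sum_mem _ fun j _ => hJpow _ (hf _ hx _ (hzy j)) _
  have e2 : ∑ j ∈ Finset.range (n + 1), f x (z * y ^ j) * y ^ (n - j)
      = ∑ i ∈ Finset.range (n + 1), x ^ i * (z * f y (x ^ (n - i))) := by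
    simp only [f, Finset.sum_mul, Finset.mul_sum]
    rw [Finset.sum_comm]
    simp only [mul_assoc]
  rw [e2, Finset.sum_range_succ] at e1
  have e3 : ∑ i ∈ Finset.range n, x ^ i * (z * f y (x ^ (n - i))) ∈ J :=
    Submodule.sum_mem _ fun i hi => hpowJ _ (hPJ (Submodule.mul_mem_mul hz
      (hf _ hy _ (pow_mem_of P hPP hx _ (by have := Finset.mem_range.mp hi; omega))))) _
  have e4 := (Submodule.add_mem_iff_right J e3).mp e1
  have e5 : f y (x ^ (n - n)) = ((n + 1 : ℕ) : C) • y ^ n := by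
    simp only [f, Nat.sub_self, pow_zero, mul_one]
    rw [Finset.sum_congr rfl (g := fun _ => y ^ n)]
    · rw [Finset.sum_const, Finset.card_range, Nat.cast_smul_eq_nsmul]
    · intro i hi
      rw [← pow_add]; congr 1; have := Finset.mem_range.mp hi; omega
  rw [e5] at e4
  have e6 : algebraMap K C ((n + 1 : ℕ) : K)⁻¹ • (x ^ n * (z * ((n + 1 : ℕ) : C) • y ^ n)) ∈ J :=
    J.smul_mem _ e4
  have e7 : algebraMap K C ((n + 1 : ℕ) : K)⁻¹ * ((n + 1 : ℕ) : C) = 1 := by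
    rw [← map_natCast (algebraMap K C), ← map_mul, inv_mul_cancel₀ (by exact_mod_cast Nat.succ_ne_zero n), map_one]
  rw [mul_smul_comm, mul_smul_comm, smul_smul, e7, one_smul, ← mul_assoc] at e6
  exact e6

lemma nagata_higman {K C G : Type*} [Field K] [CharZero K] [CommRing C] [Algebra K C]
    [Ring G] [Algebra C G] (P : Submodule C G) (hPP : P * P ≤ P) (n : ℕ) :
    ∀ (J : Submodule C G) (_ : J ≤ P) (_ : P * J ≤ J)
    (_ : J * P ≤ J) (_ : ∀ a ∈ P, a ^ (n + 1) ∈ J), P ^ (2 ^ (n + 1) - 1) ≤ J := by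
  induction n with
  | zero =>
    intro J _ _ _ h
    simpa using! h
  | succ n ih =>
    intro J hJ hPJ hJP h
    let Q : Submodule C G := 1 ⊔ P
    let W : Submodule C G := Submodule.span C ((fun x => x ^ (n + 1)) '' (P : Set G))
    have hPQ : P * Q ≤ P := by
      simp only [Q, Submodule.mul_sup, mul_one, sup_le_iff, le_refl, true_and, hPP]
    have hQP : Q * P ≤ P := by
      simp only [Q, Submodule.sup_mul, one_mul, sup_le_iff, le_refl, true_and, hPP]
    have hJQ : J * Q ≤ J := by
      simp only [Q, Submodule.mul_sup, mul_one, sup_le_iff, le_refl, true_and, hJP]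
    have hQJ : Q * J ≤ J := by
      simp only [Q, Submodule.sup_mul, one_mul, sup_le_iff, le_refl, true_and, hPJ]
    have hPleQ : P ≤ Q := le_sup_right
    have h1Q : 1 ≤ Q := le_sup_left
    have hWP : W ≤ P := by
      rw [Submodule.span_le]
      rintro _ ⟨x, hx, rfl⟩
      exact pow_mem_of P hPP hx _ (by omega)
    have hWPW : W * P * W ≤ J := by
      have : P = Submodule.span C (P : Set G) := (Submodule.span_eq P).symm
      rw [this, Submodule.span_mul_span, Submodule.span_mul_span, Submodule.span_le]
      rintro _ ⟨_, ⟨_, ⟨x, hx, rfl⟩, z, hz, rfl⟩, _, ⟨y, hy, rfl⟩, rfl⟩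
      exact higman_id (K := K) P J hPP hPJ hJP (n + 1) h x y z hx hy hz
    let I : Submodule C G := J ⊔ Q * W * Q
    have hQWQ : Q * W * Q ≤ P :=
      (mul_le_mul' (((mul_le_mul' le_rfl hWP)).trans hQP) le_rfl).trans hPQ
    have hI : I ≤ P := sup_le hJ hQWQ
    have hPI : P * I ≤ I := by
      simp only [I, Submodule.mul_sup]
      refine sup_le_sup hPJ ?_
      rw [← mul_assoc, ← mul_assoc]
      exact mul_le_mul' (mul_le_mul' (hPQ.trans hPleQ) le_rfl) le_rfl
    have hIP : I * P ≤ I := by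
      simp only [I, Submodule.sup_mul]
      refine sup_le_sup hJP ?_
      rw [mul_assoc]
      exact mul_le_mul' le_rfl (hQP.trans hPleQ)
    have hWI : W ≤ I := by
      refine le_trans ?_ le_sup_right
      calc W = 1 * W * 1 := by simp
        _ ≤ Q * W * Q := mul_le_mul' (mul_le_mul' h1Q le_rfl) h1Q
    have h2 := ih I hI hPI hIP (fun a ha => hWI (Submodule.subset_span ⟨a, ha, rfl⟩))
    have h3 : 2 ^ (n + 1 + 1) - 1 = (2 ^ (n + 1) - 1) + 1 + (2 ^ (n + 1) - 1) := by
      have : 1 ≤ 2 ^ (n + 1) := Nat.one_le_two_pow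
      rw [pow_succ 2 (n + 1)]; omega
    rw [h3, pow_add, pow_add, pow_one]
    refine (mul_le_mul' (mul_le_mul' h2 le_rfl) h2).trans ?_
    have h4 : Q * W * Q * P * (Q * W * Q) ≤ J := by
      calc Q * W * Q * P * (Q * W * Q) = Q * (W * (Q * P * Q) * W) * Q := by simp only [mul_assoc]
        _ ≤ Q * (W * P * W) * Q := by
          refine mul_le_mul' (mul_le_mul' le_rfl (mul_le_mul'
            (mul_le_mul' le_rfl ?_) le_rfl)) le_rfl
          exact (mul_le_mul' hQP le_rfl).trans hPQ
        _ ≤ Q * J * Q := mul_le_mul' (mul_le_mul' le_rfl hWPW) le_rfl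
        _ ≤ J := (mul_le_mul' hQJ le_rfl).trans hJQ
    have h5 : J * P * I ≤ J := (mul_le_mul' hJP hI).trans hJP
    have h6 : I * P * J ≤ J := by
      rw [mul_assoc]
      exact (mul_le_mul' hI hPJ).trans hPJ
    calc I * P * I = J * P * I ⊔ (Q * W * Q * P * J ⊔ Q * W * Q * P * (Q * W * Q)) := by
          conv_lhs => rw [show I * P * I = (J ⊔ Q * W * Q) * P * I from rfl]
          rw [Submodule.sup_mul, Submodule.sup_mul, ← Submodule.mul_sup]
      _ ≤ J := sup_le h5 (sup_le
          ((mul_le_mul' (mul_le_mul' le_sup_right le_rfl) le_rfl).trans h6) h4)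
end

section
open Polynomial

structure IsCH {C R : Type*} [CommRing C] [Ring R] [Algebra C R] (n : ℕ)
    (tr : R →ₗ[C] C) (c : ℕ → R → C) : Prop where
  cyc : ∀ x y : R, tr (x * y) = tr (y * x)
  one : tr 1 = (n : C)
  c0 : ∀ a : R, c 0 a = 1
  newton : ∀ i : ℕ, 1 ≤ i → ∀ a : R,
      (i : C) * c i a = ∑ j ∈ Finset.Icc 1 i, (-1 : C) ^ (j - 1) * c (i - j) a * tr (a ^ j)
  ch : ∀ a : R, ∑ i ∈ Finset.range (n + 1), ((-1 : C) ^ i * c i a) • a ^ (n - i) = 0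

noncomputable def polyTr {C R : Type*} [CommRing C] [Ring R] [Algebra C R]
    (tr : R →ₗ[C] C) (p : R[X]) : C[X] :=
  ∑ k ∈ p.support, monomial k (tr (p.coeff k))

lemma polyTr_coeff {C R : Type*} [CommRing C] [Ring R] [Algebra C R]
    (tr : R →ₗ[C] C) (p : R[X]) (k : ℕ) : (polyTr tr p).coeff k = tr (p.coeff k) := by
  simp only [polyTr, finsetSum_coeff, coeff_monomial]
  rw [Finset.sum_ite_eq']
  split_ifs with h
  · rfl
  · rw [notMem_support_iff.mp h, map_zero]

noncomputable def evN {R : Type*} [Ring R] (t : ℕ) : R[X] →+* R :=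
  eval₂RingHom' (RingHom.id R) (t : R) (fun a => (Nat.cast_commute t a).symm)

lemma evN_apply {C R : Type*} [CommRing C] [Ring R] [Algebra C R] (t : ℕ) (p : R[X]) (N : ℕ)
    (hN : p.natDegree < N) :
    evN t p = ∑ k ∈ Finset.range N, (t : C) ^ k • p.coeff k := by
  change eval₂ (RingHom.id R) (t : R) p = _
  rw [eval₂_eq_sum_range' _ hN]
  refine Finset.sum_congr rfl fun k _ => ?_
  rw [Algebra.smul_def]
  simp only [RingHom.id_apply, map_pow, map_natCast]
  exact (((Nat.cast_commute t (p.coeff k)).pow_left k).eq).symm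

lemma eval_polyTr {C R : Type*} [CommRing C] [Ring R] [Algebra C R]
    (tr : R →ₗ[C] C) (p : R[X]) (t : ℕ) : (polyTr tr p).eval (t : C) = tr (evN t p) := by
  have h1 : (polyTr tr p).natDegree < p.natDegree + 1 := by
    refine Nat.lt_succ_of_le (natDegree_le_iff_coeff_eq_zero.mpr fun k hk => ?_)
    rw [polyTr_coeff, coeff_eq_zero_of_natDegree_lt hk, map_zero]
  rw [evN_apply (C := C) t p _ (Nat.lt_succ_self _), eval_eq_sum_range' h1, map_sum]
  refine Finset.sum_congr rfl fun k _ => ?_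
  rw [polyTr_coeff, map_smul, smul_eq_mul, mul_comm]

lemma evN_map {C R : Type*} [CommRing C] [Ring R] [Algebra C R] (t : ℕ) (q : C[X]) :
    evN t (q.map (algebraMap C R)) = algebraMap C R (q.eval (t : C)) := by
  change eval₂ (RingHom.id R) (t : R) _ = _
  rw [eval₂_map, eval, hom_eval₂]
  simp

lemma exists_charpoly_coeff {K C R : Type*} [Field K] [CharZero K] [CommRing C] [Algebra K C]
    [Ring R] [Algebra C R]
    {n : ℕ} {tr : R →ₗ[C] C} {c : ℕ → R → C} (H : IsCH n tr c) (p : R[X]) (hp : p.coeff 0 = 0) :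
    ∀ i : ℕ, ∃ q : C[X], (i = 0 → q = 1) ∧ (1 ≤ i → q.coeff 0 = 0) ∧
      ∀ t : ℕ, q.eval (t : C) = c i (evN t p) := by
  intro i
  induction i using Nat.strong_induction_on with
  | _ i ih =>
    rcases Nat.eq_zero_or_pos i with rfl | hi
    · exact ⟨1, fun _ => rfl, fun h => absurd h (by norm_num), fun t => by simp [H.c0]⟩
    · choose q hq using fun j : Fin i => ih j.1 j.2
      let q' : ℕ → C[X] := fun j => if h : j < i then q ⟨j, h⟩ else 0
      have hq' : ∀ j < i, ∀ t : ℕ, (q' j).eval (t : C) = c j (evN t p) := by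
        intro j hj t
        simp only [q', dif_pos hj]
        exact (hq ⟨j, hj⟩).2.2 t
      have hinv : algebraMap K C ((i : K)⁻¹) * (i : C) = 1 := by
        rw [← map_natCast (algebraMap K C), ← map_mul, inv_mul_cancel₀ (by exact_mod_cast hi.ne'),
          map_one]
      refine ⟨Polynomial.C (algebraMap K C ((i : K)⁻¹)) * ∑ j ∈ Finset.Icc 1 i,
        (-1) ^ (j - 1) * q' (i - j) * polyTr tr (p ^ j), fun h => absurd h hi.ne', fun _ => ?_,
        fun t => ?_⟩
      · rw [coeff_C_mul, finsetSum_coeff, Finset.sum_eq_zero, mul_zero]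
        intro j hj
        have : j ≠ 0 := by have := Finset.mem_Icc.mp hj; omega
        have hpj : (p ^ j).coeff 0 = 0 := by
          rw [← constantCoeff_apply, map_pow, constantCoeff_apply, hp, zero_pow this]
        rw [mul_coeff_zero, polyTr_coeff, hpj, map_zero, mul_zero]
      · have e : ∑ j ∈ Finset.Icc 1 i, eval (t : C) ((-1) ^ (j - 1) * q' (i - j) * polyTr tr (p ^ j))
          = (i : C) * c i (evN t p) := by
          rw [H.newton i hi]
          refine Finset.sum_congr rfl fun j hj => ?_
          have := Finset.mem_Icc.mp hj
          rw [eval_mul, eval_mul, eval_polyTr, hq' _ (by omega), map_pow]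
          simp
        rw [eval_mul, eval_C, eval_finsetSum, e, ← mul_assoc, hinv, one_mul]

lemma poly_CH {K C R : Type*} [Field K] [CharZero K] [CommRing C] [Algebra K C]
    [Ring R] [Algebra C R]
    {n : ℕ} {tr : R →ₗ[C] C} {c : ℕ → R → C} (H : IsCH n tr c) (p : R[X]) (hp : p.coeff 0 = 0) :
    ∃ q : ℕ → C[X], q 0 = 1 ∧ (∀ i, 1 ≤ i → (q i).coeff 0 = 0) ∧
      ∑ i ∈ Finset.range (n + 1), (-1) ^ i * (q i).map (algebraMap C R) * p ^ (n - i) = 0 := by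
  choose q h0 h1 h2 using exists_charpoly_coeff (K := K) H p hp
  refine ⟨q, h0 0 rfl, h1, ?_⟩
  set E := ∑ i ∈ Finset.range (n + 1), (-1) ^ i * (q i).map (algebraMap C R) * p ^ (n - i) with hE
  have hev : ∀ t : ℕ, evN t E = 0 := by
    intro t
    rw [hE, map_sum, ← H.ch (evN t p)]
    refine Finset.sum_congr rfl fun i _ => ?_
    rw [map_mul, map_mul, evN_map, h2, Algebra.smul_def]
    simp
  ext k
  rw [coeff_zero]
  by_cases hk : k < E.natDegree + 1
  · have := vander_aux (K := K) (⊥ : Submodule C R) (E.natDegree + 1) E.coeff (fun t => by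
      rw [← evN_apply (C := C) t E _ (Nat.lt_succ_self _), hev]; exact Submodule.zero_mem _) k hk
    simpa using this
  · exact coeff_eq_zero_of_natDegree_lt (by omega)

section Rees
variable {C R : Type*} [CommRing C] [Ring R] [Algebra C R]

def reesP (A : Submodule C R) : Submodule C R[X] where
  carrier := {p | p.coeff 0 = 0 ∧ ∀ k, p.coeff k ∈ A ^ k}
  zero_mem' := ⟨by simp, fun k => by simp⟩
  add_mem' := fun {p q} hp hq => ⟨by simp [hp.1, hq.1], fun k => by
    rw [coeff_add]; exact add_mem (hp.2 k) (hq.2 k)⟩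
  smul_mem' := fun r p hp => ⟨by simp [hp.1], fun k => by
    rw [coeff_smul]; exact Submodule.smul_mem _ _ (hp.2 k)⟩

def reesJ (A : Submodule C R) : Submodule C R[X] where
  carrier := {p | p.coeff 0 = 0 ∧ ∀ k, p.coeff k ∈ A ^ (k - 1)}
  zero_mem' := ⟨by simp, fun k => by simp⟩
  add_mem' := fun {p q} hp hq => ⟨by simp [hp.1, hq.1], fun k => by
    rw [coeff_add]; exact add_mem (hp.2 k) (hq.2 k)⟩
  smul_mem' := fun r p hp => ⟨by simp [hp.1], fun k => by
    rw [coeff_smul]; exact Submodule.smul_mem _ _ (hp.2 k)⟩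

variable (A : Submodule C R)

lemma rees_PP : reesP A * reesP A ≤ reesP A := by
  rw [Submodule.mul_le]
  intro p hp q hq
  refine ⟨by rw [mul_coeff_zero, hp.1, zero_mul], fun k => ?_⟩
  rw [coeff_mul]
  refine Submodule.sum_mem _ fun x hx => ?_
  rw [← Finset.HasAntidiagonal.mem_antidiagonal.mp hx, pow_add]
  exact Submodule.mul_mem_mul (hp.2 _) (hq.2 _)

lemma rees_PJ : reesP A * reesJ A ≤ reesJ A := by
  rw [Submodule.mul_le]
  intro p hp q hq
  refine ⟨by rw [mul_coeff_zero, hp.1, zero_mul], fun k => ?_⟩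
  rw [coeff_mul]
  refine Submodule.sum_mem _ fun x hx => ?_
  rcases Nat.eq_zero_or_pos x.2 with h | h
  · rw [h, hq.1, mul_zero]; exact Submodule.zero_mem _
  · have h' : k - 1 = x.1 + (x.2 - 1) := by have := Finset.HasAntidiagonal.mem_antidiagonal.mp hx; omega
    rw [h', pow_add]
    exact Submodule.mul_mem_mul (hp.2 _) (hq.2 _)

lemma rees_JP : reesJ A * reesP A ≤ reesJ A := by
  rw [Submodule.mul_le]
  intro p hp q hq
  refine ⟨by rw [mul_coeff_zero, hp.1, zero_mul], fun k => ?_⟩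
  rw [coeff_mul]
  refine Submodule.sum_mem _ fun x hx => ?_
  rcases Nat.eq_zero_or_pos x.1 with h | h
  · rw [h, hp.1, zero_mul]; exact Submodule.zero_mem _
  · have h' : k - 1 = (x.1 - 1) + x.2 := by have := Finset.HasAntidiagonal.mem_antidiagonal.mp hx; omega
    rw [h', pow_add]
    exact Submodule.mul_mem_mul (hp.2 _) (hq.2 _)

lemma pow_mono_of_one_le {A : Submodule C R} (hA : 1 ≤ A) {i j : ℕ} (h : i ≤ j) : A ^ i ≤ A ^ j := by
  induction j, h using Nat.le_induction with
  | base => exact le_rfl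
  | succ j _ ih =>
    refine ih.trans ?_
    calc A ^ j = A ^ j * 1 := (mul_one _).symm
      _ ≤ A ^ j * A := mul_le_mul' le_rfl hA
      _ = A ^ (j + 1) := (pow_succ _ _).symm

lemma rees_JleP (hA : 1 ≤ A) : reesJ A ≤ reesP A :=
  fun _ hp => ⟨hp.1, fun k => pow_mono_of_one_le hA (Nat.sub_le k 1) (hp.2 k)⟩

lemma rees_pow {p : R[X]} (hp : p ∈ reesP A) (m : ℕ) : ∀ k, (p ^ m).coeff k ∈ A ^ k := by
  induction m with
  | zero =>
    intro k
    rw [pow_zero, coeff_one]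
    split_ifs with h
    · subst h; rw [pow_zero]; exact Submodule.one_le.mp le_rfl
    · exact Submodule.zero_mem _
  | succ m ih =>
    intro k
    rw [pow_succ, coeff_mul]
    refine Submodule.sum_mem _ fun x hx => ?_
    rw [← Finset.HasAntidiagonal.mem_antidiagonal.mp hx, pow_add]
    exact Submodule.mul_mem_mul (ih _) (hp.2 _)

lemma rees_nil {K : Type*} [Field K] [CharZero K] [Algebra K C] (hA : 1 ≤ A)
    {n : ℕ} {tr : R →ₗ[C] C} {c : ℕ → R → C} (H : IsCH n tr c) {p : R[X]} (hp : p ∈ reesP A) :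
    p ^ n ∈ reesJ A := by
  obtain ⟨q, h0, h1, h2⟩ := poly_CH (K := K) H p hp.1
  rw [Finset.sum_range_succ'] at h2
  simp only [pow_zero, h0, Polynomial.map_one, one_mul, Nat.sub_zero] at h2
  rw [eq_neg_of_add_eq_zero_right h2]
  refine neg_mem (Submodule.sum_mem _ fun i _ => ?_)
  have h3 : (q (i + 1)).map (algebraMap C R) * p ^ (n - (i + 1)) ∈ reesJ A := by
    refine ⟨by rw [mul_coeff_zero, coeff_map, h1 _ (by omega), map_zero, zero_mul], fun k => ?_⟩
    rw [coeff_mul]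
    refine Submodule.sum_mem _ fun x hx => ?_
    rw [coeff_map]
    rcases Nat.eq_zero_or_pos x.1 with h | h
    · rw [h, h1 _ (by omega), map_zero, zero_mul]; exact Submodule.zero_mem _
    · rw [← Algebra.smul_def]
      refine Submodule.smul_mem _ _ (pow_mono_of_one_le hA ?_ (rees_pow A hp _ _))
      have := Finset.HasAntidiagonal.mem_antidiagonal.mp hx; omega
  rw [mul_assoc]
  rcases neg_one_pow_eq_or R[X] (i + 1) with h | h <;> rw [h]
  · rwa [one_mul]
  · rw [neg_one_mul]; exact neg_mem h3

lemma rees_monomial (k : ℕ) : ∀ r ∈ A ^ k, (monomial k r : R[X]) ∈ reesP A ^ k := by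
  induction k with
  | zero =>
    intro r hr
    rw [pow_zero, Submodule.mem_one] at hr ⊢
    obtain ⟨y, rfl⟩ := hr
    exact ⟨y, rfl⟩
  | succ k ih =>
    intro r hr
    rw [pow_succ] at hr
    refine Submodule.mul_induction_on hr (fun a ha b hb => ?_) (fun a b ha hb => ?_)
    · rw [← monomial_mul_monomial, pow_succ]
      refine Submodule.mul_mem_mul (ih a ha) ⟨by simp [coeff_monomial], fun j => ?_⟩
      rw [coeff_monomial]
      split_ifs with h
      · subst h; simpa
      · exact Submodule.zero_mem _
    · rw [map_add]; exact add_mem ha hb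

end Rees

theorem CH_finite {K C R : Type*} [Field K] [CharZero K] [CommRing C] [Algebra K C]
    [Ring R] [Algebra K R] [Algebra C R] [IsScalarTower K C R] [Algebra.FiniteType K R]
    {n : ℕ} (hn : 0 < n) {tr : R →ₗ[C] C} {c : ℕ → R → C} (H : IsCH n tr c) :
    Module.Finite C R := by
  obtain ⟨s, hs⟩ := (Algebra.FiniteType.out : (⊤ : Subalgebra K R).FG)
  classical
  let A : Submodule C R := Submodule.span C (↑(insert 1 s : Finset R) : Set R)
  have hA1 : 1 ≤ A := by
    rw [Submodule.one_le]; exact Submodule.subset_span (by simp)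
  obtain ⟨n, rfl⟩ := Nat.exists_eq_succ_of_ne_zero hn.ne'
  have h1 := nagata_higman (K := K) (reesP A) (rees_PP A) n (reesJ A) (rees_JleP A hA1)
    (rees_PJ A) (rees_JP A) (fun a ha => rees_nil A (K := K) hA1 H ha)
  obtain ⟨N, hN⟩ : ∃ N, 2 ^ (n + 1) - 1 = N + 1 :=
    ⟨2 ^ (n + 1) - 2, by have : 2 ≤ 2 ^ (n + 1) := by
                          rw [pow_succ]; have : 1 ≤ 2 ^ n := Nat.one_le_two_pow
                          omega
                         omega⟩
  rw [hN] at h1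
  have h2 : A ^ (N + 1) ≤ A ^ N := by
    intro r hr
    have := (h1 (rees_monomial A _ r hr)).2 (N + 1)
    simpa using this
  have h3 : ∀ k, A ^ k ≤ A ^ N := by
    intro k
    rcases le_total k N with h | h
    · exact pow_mono_of_one_le hA1 h
    · induction k, h using Nat.le_induction with
      | base => exact le_rfl
      | succ k _ ih =>
        rw [pow_succ]
        refine (mul_le_mul' ih le_rfl).trans ?_
        rw [← pow_succ]; exact h2
  let B : Subalgebra K R :=
    { carrier := (A ^ N : Submodule C R)
      mul_mem' := fun {a b} ha hb => h3 (N + N) (by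
        rw [pow_add]; exact Submodule.mul_mem_mul ha hb)
      one_mem' := h3 0 (by rw [pow_zero]; exact Submodule.one_le.mp le_rfl)
      add_mem' := fun ha hb => add_mem ha hb
      zero_mem' := Submodule.zero_mem _
      algebraMap_mem' := fun r => h3 0 (by
        rw [pow_zero, Submodule.mem_one]
        exact ⟨algebraMap K C r, (IsScalarTower.algebraMap_apply K C R r).symm⟩) }
  have hB : B = ⊤ := by
    rw [eq_top_iff, ← hs, Algebra.adjoin_le_iff]
    intro x hx
    refine h3 1 ?_
    rw [pow_one]
    exact Submodule.subset_span (by simp at hx ⊢; exact Or.inr hx)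
  refine ⟨?_⟩
  have : (⊤ : Submodule C R) = A ^ N := by
    symm
    rw [eq_top_iff]
    intro x _
    have : x ∈ B := by rw [hB]; trivial
    exact this
  rw [this]
  exact Submodule.FG.pow (Submodule.fg_span (Finset.finite_toSet _)) N
end

section
open Polynomial

section
variable {F S : Type*} [Field F] [CharZero F] [Ring S] [Algebra F S]
  {n : ℕ} {tr : S →ₗ[F] F} {c : ℕ → S → F}

lemma IsCH.tr_nilpotent [Nontrivial S] (H : IsCH n tr c) {a : S} (ha : IsNilpotent a) : tr a = 0 := by
  by_contra hne
  obtain ⟨k, hk⟩ := ha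
  have hbig : ∀ j, k ≤ j → tr (a ^ j) = 0 := fun j hj => by
    rw [pow_eq_zero_of_le hj hk, map_zero]
  have hex : ∃ r, 1 ≤ r ∧ tr (a ^ r) ≠ 0 ∧ ∀ s, r < s → tr (a ^ s) = 0 := by
    classical
    have h1k : 1 ≤ k := by
      by_contra h
      exact hne (by simpa using hbig 1 (by omega))
    let r := Nat.findGreatest (fun r => tr (a ^ r) ≠ 0) k
    refine ⟨r, Nat.le_findGreatest h1k (by simpa using hne), ?_, fun s hs => ?_⟩
    · exact Nat.findGreatest_spec (P := fun r => tr (a ^ r) ≠ 0) h1k (by simpa using hne)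
    · by_cases hsk : s ≤ k
      · simpa using Nat.findGreatest_is_greatest hs hsk
      · exact hbig s (by omega)
  obtain ⟨r, hr, hr0, hr1⟩ := hex
  have hb : IsNilpotent (a ^ r) := ⟨k, by
    rw [← pow_mul]; exact pow_eq_zero_of_le (Nat.le_mul_of_pos_left k hr) hk⟩
  set b := a ^ r with hbdef
  have hb2 : ∀ j, 2 ≤ j → tr (b ^ j) = 0 := fun j hj => by
    rw [hbdef, ← pow_mul]; exact hr1 _ (by nlinarith)
  have hc : ∀ i, c i b ≠ 0 := by
    intro i
    induction i with
    | zero => rw [H.c0]; exact one_ne_zero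
    | succ i ih =>
      have h := H.newton (i + 1) (by omega) b
      rw [Finset.sum_eq_single 1] at h
      · intro h0
        rw [h0] at h
        simp only [mul_zero, Nat.sub_self, pow_zero, one_mul, Nat.add_sub_cancel, pow_one] at h
        exact mul_ne_zero ih hr0 h.symm
      · intro j hj hj1
        have := Finset.mem_Icc.mp hj
        rw [hb2 j (by omega), mul_zero]
      · intro h1
        exact absurd (Finset.mem_Icc.mpr ⟨le_rfl, by omega⟩) h1
  have hpos := pos_nilpotencyClass_iff.mpr hb
  have hz : b ^ nilpotencyClass b = 0 := pow_nilpotencyClass hb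
  have hnz : b ^ (nilpotencyClass b - 1) ≠ 0 := pow_pred_nilpotencyClass hb
  have h := congrArg (· * b ^ (nilpotencyClass b - 1)) (H.ch b)
  simp only [zero_mul, Finset.sum_mul, smul_mul_assoc, ← pow_add] at h
  rw [Finset.sum_eq_single n] at h
  · rw [Nat.sub_self, zero_add] at h
    rcases smul_eq_zero.mp h with h | h
    · exact mul_ne_zero (pow_ne_zero _ (neg_ne_zero.mpr one_ne_zero)) (hc n) h
    · exact hnz h
  · intro i hi hin
    have := Finset.mem_range.mp hi
    rw [pow_eq_zero_of_le (by omega) hz, smul_zero]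
  · intro h1
    exact absurd (Finset.mem_range.mpr (by omega)) h1

lemma IsCH.tr_idempotent (H : IsCH n tr c) {e : S} (he : e * e = e) (he0 : e ≠ 0) :
    ∃ k : ℕ, 1 ≤ k ∧ tr e = k := by
  have hpow : ∀ j, 1 ≤ j → e ^ j = e := by
    intro j hj
    induction j, hj using Nat.le_induction with
    | base => simp
    | succ j _ ih => rw [pow_succ, ih, he]
  set t := tr e with ht
  let s : ℕ → F := fun i => ∑ l ∈ Finset.range i, (-1 : F) ^ (i - 1 - l) * c l e
  have hs1 : s 1 = 1 := by simp [s, H.c0]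
  have hsr : ∀ i, s (i + 1) = c i e - s i := by
    intro i
    simp only [s, Finset.sum_range_succ, Nat.add_sub_cancel, Nat.sub_self, pow_zero, one_mul]
    rw [add_comm, sub_eq_add_neg, ← Finset.sum_neg_distrib]
    congr 1
    refine Finset.sum_congr rfl fun l hl => ?_
    have : i - l = (i - 1 - l) + 1 := by have := Finset.mem_range.mp hl; omega
    rw [this, pow_succ]; ring
  have hic : ∀ i : ℕ, 1 ≤ i → (i : F) * c i e = t * s i := by
    intro i hi
    rw [H.newton i hi, Finset.mul_sum]
    refine Finset.sum_bij' (fun j _ => i - j) (fun l _ => i - l) ?_ ?_ ?_ ?_ ?_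
    · intro j hj
      have := Finset.mem_Icc.mp hj
      exact Finset.mem_range.mpr (by omega)
    · intro l hl
      have := Finset.mem_range.mp hl
      exact Finset.mem_Icc.mpr ⟨by omega, by omega⟩
    · intro j hj
      have := Finset.mem_Icc.mp hj
      omega
    · intro l hl
      have := Finset.mem_range.mp hl
      omega
    · intro j hj
      have := Finset.mem_Icc.mp hj
      rw [hpow j this.1, show i - 1 - (i - j) = j - 1 by omega, ← ht]
      ring
  have hstep : ∀ i : ℕ, 1 ≤ i → (i : F) * s (i + 1) = (t - i) * s i := by
    intro i hi
    rw [hsr, mul_sub, hic i hi]; ring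
  have hsn : s (n + 1) = 0 := by
    have h := congrArg (· * e) (H.ch e)
    simp only [zero_mul, Finset.sum_mul, smul_mul_assoc, ← pow_succ] at h
    rw [Finset.sum_congr rfl (g := fun i => ((-1 : F) ^ i * c i e) • e)
      (fun i _ => by rw [hpow _ (by omega)]), ← Finset.sum_smul] at h
    have h' := (smul_eq_zero.mp h).resolve_right he0
    have : s (n + 1) = (-1) ^ n * ∑ i ∈ Finset.range (n + 1), (-1 : F) ^ i * c i e := by
      rw [Finset.mul_sum]
      refine Finset.sum_congr rfl fun l hl => ?_
      have hl' : n = (n - l) + l := by have := Finset.mem_range.mp hl; omega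
      rw [← mul_assoc, ← pow_add, Nat.add_sub_cancel]
      congr 1
      conv_rhs => rw [hl', add_assoc, pow_add, ← two_mul, pow_mul]
      simp
    rw [this, h', mul_zero]
  by_contra hcon
  push Not at hcon
  have : ∀ i, s (i + 1) ≠ 0 := by
    intro i
    induction i with
    | zero => rw [hs1]; exact one_ne_zero
    | succ i ih =>
      intro h0
      have h := hstep (i + 1) (by omega)
      rw [h0, mul_zero] at h
      exact mul_ne_zero (sub_ne_zero.mpr (hcon (i + 1) (by omega))) ih h.symm
  exact this n hsn
end

lemma surj_matrix {F S : Type*} [Field F] [CharZero F] [IsAlgClosed F] [Ring S] [Algebra F S]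
    [FiniteDimensional F S] {n : ℕ} (hn : 0 < n) {tr : S →ₗ[F] F} {c : ℕ → S → F}
    (H : IsCH n tr c) (hnd : ∀ x, (∀ y, tr (x * y) = 0) → x = 0)
    (hdim : n ^ 2 ≤ Module.finrank F S) :
    ∃ f : S →ₐ[F] Matrix (Fin n) (Fin n) F, Function.Surjective f := by
  have hpos : 0 < Module.finrank F S := lt_of_lt_of_le (by positivity) hdim
  have : Nontrivial S := Module.nontrivial_of_finrank_pos hpos
  have : IsArtinianRing S := IsArtinianRing.of_finite F S
  have hss : IsSemisimpleRing S := by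
    rw [IsArtinianRing.isSemisimpleRing_iff_jacobson, eq_bot_iff]
    intro x hx
    refine hnd x fun y => H.tr_nilpotent ?_
    obtain ⟨k, hk⟩ := (IsSemiprimaryRing.isNilpotent : IsNilpotent (Ring.jacobson S))
    refine ⟨k, ?_⟩
    have h1 : x * y ∈ Ring.jacobson S := Ideal.mul_mem_right _ _ hx
    have h2 := Ideal.pow_mem_pow h1 k
    rw [hk] at h2
    simpa using h2
  obtain ⟨r, d, hd, ⟨e⟩⟩ := IsSemisimpleRing.exists_algEquiv_pi_matrix_of_isAlgClosed F S
  let E : (i : Fin r) → Fin (d i) → S := fun i a => e.symm (Pi.single i (Matrix.single a a 1))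
  have hE : ∀ i a, ∃ k : ℕ, 1 ≤ k ∧ tr (E i a) = k := by
    intro i a
    refine H.tr_idempotent ?_ ?_
    · rw [← map_mul, ← Pi.single_mul, Matrix.single_mul_single_same, mul_one]
    · intro h0
      have := (map_eq_zero_iff e.symm e.symm.injective).mp h0
      have h2 := congrFun (congrFun (congrFun this i) a) a
      simp at h2
  choose k hk1 hk using hE
  have hsum : ∑ i, ∑ a, E i a = 1 := by
    simp only [E, ← map_sum]
    rw [map_eq_one_iff e.symm e.symm.injective]
    have h1 : ∀ i, ∑ a, (Pi.single i (Matrix.single a a 1) :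
        (i : Fin r) → Matrix (Fin (d i)) (Fin (d i)) F) = Pi.single i 1 := by
      intro i
      have h2 : ∑ a : Fin (d i), Matrix.single a a (1 : F) = 1 := by
        ext a b
        simp [Matrix.sum_apply, Matrix.one_apply, Matrix.single_apply, ite_and]
      rw [← h2]
      exact (map_sum (AddMonoidHom.single
        (fun i : Fin r => Matrix (Fin (d i)) (Fin (d i)) F) i) _ _).symm
    simp_rw [h1]
    exact Finset.univ_sum_single (1 : (i : Fin r) → Matrix (Fin (d i)) (Fin (d i)) F)
  have hn' : n = ∑ i, ∑ a, k i a := by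
    have h := congrArg tr hsum
    simp only [map_sum, hk, H.one] at h
    exact_mod_cast h.symm
  have hdn : ∑ i, d i ≤ n := by
    rw [hn']
    refine Finset.sum_le_sum fun i _ => ?_
    calc d i = ∑ a : Fin (d i), 1 := by simp
      _ ≤ _ := Finset.sum_le_sum fun a _ => hk1 i a
  have hfin : Module.finrank F S = ∑ i, d i * d i := by
    rw [e.toLinearEquiv.finrank_eq, Module.finrank_pi_fintype]
    simp [Module.finrank_matrix]
  have hex : ∃ i, d i = n := by
    by_contra hcon
    push Not at hcon
    have h1 : ∀ i, d i ≤ n - 1 := fun i => by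
      have h1 : d i ≤ ∑ i, d i := Finset.single_le_sum (f := d) (fun _ _ => Nat.zero_le _) (Finset.mem_univ i)
      have := hcon i
      omega
    have h2 : ∑ i, d i * d i ≤ (∑ i, d i) * (n - 1) := by
      rw [Finset.sum_mul]
      exact Finset.sum_le_sum fun i _ => Nat.mul_le_mul_left _ (h1 i)
    have h3 : (∑ i, d i) * (n - 1) ≤ n * (n - 1) := Nat.mul_le_mul_right _ hdn
    have h4 : n * (n - 1) < n ^ 2 := by
      rw [pow_two]; exact Nat.mul_lt_mul_of_pos_left (by omega) hn
    omega
  obtain ⟨i, rfl⟩ := hex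
  exact ⟨(Pi.evalAlgHom F _ i).comp e.toAlgHom,
    (Function.surjective_eval i).comp e.surjective⟩

lemma base_eq {K F S : Type*} [Field K] [IsAlgClosed K] [Field F] [Algebra K F] [Ring S]
    [Nontrivial S] [Algebra K S] [Algebra F S] [IsScalarTower K F S] [Algebra.FiniteType K S]
    [Module.Finite F S] : Function.Bijective (algebraMap K F) := by
  classical
  obtain ⟨s, hs⟩ := (Algebra.FiniteType.out : (⊤ : Subalgebra K S).FG)
  let b := Module.finBasis F S
  let ι := Fin (Module.finrank F S)
  let T : Set F := Set.range (fun x : ι × ι × ι => b.repr (b x.1 * b x.2.1) x.2.2) ∪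
    Set.range (fun x : s × ι => b.repr x.1.1 x.2) ∪ Set.range (fun i : ι => b.repr 1 i)
  have hT : T.Finite := ((Set.finite_range _).union (Set.finite_range _)).union (Set.finite_range _)
  let F0 := Algebra.adjoin K T
  let B : Subalgebra K S :=
    { carrier := {x | ∀ i, b.repr x i ∈ F0}
      mul_mem' := by
        intro x y hx hy i
        rw [← b.sum_repr x, ← b.sum_repr y, Finset.sum_mul_sum]
        simp only [smul_mul_smul_comm, map_sum, map_smul, Finsupp.coe_finsetSum, Finset.sum_apply,
          Finsupp.smul_apply, smul_eq_mul]
        refine sum_mem fun j _ => sum_mem fun k _ => mul_mem (mul_mem (hx j) (hy k)) ?_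
        exact Algebra.subset_adjoin (Or.inl (Or.inl ⟨(j, k, i), rfl⟩))
      add_mem' := by
        intro x y hx hy i
        rw [map_add]; exact add_mem (hx i) (hy i)
      algebraMap_mem' := by
        intro k i
        rw [IsScalarTower.algebraMap_apply K F S, Algebra.algebraMap_eq_smul_one, map_smul]
        exact mul_mem (F0.algebraMap_mem k) (Algebra.subset_adjoin (Or.inr ⟨i, rfl⟩)) }
  have hB : B = ⊤ := by
    rw [eq_top_iff, ← hs, Algebra.adjoin_le_iff]
    intro x hx i
    exact Algebra.subset_adjoin (Or.inl (Or.inr ⟨(⟨x, hx⟩, i), rfl⟩))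
  have hpos : 0 < Module.finrank F S := Module.finrank_pos
  have hF0 : F0 = ⊤ := by
    rw [eq_top_iff]
    intro f _
    have : f • b ⟨0, hpos⟩ ∈ B := by rw [hB]; trivial
    simpa using this ⟨0, hpos⟩
  have : Algebra.FiniteType K F := ⟨⟨hT.toFinset, by rw [hT.coe_toFinset]; exact hF0⟩⟩
  have := finite_of_finite_type_of_isJacobsonRing K F
  exact IsAlgClosed.algebraMap_bijective_of_isIntegral

theorem core {K F : Type u} {S : Type*} [Field K] [CharZero K] [IsAlgClosed K] [Field F] [Algebra K F] [Ring S]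
    [Algebra K S] [Algebra F S] [IsScalarTower K F S] [Algebra.FiniteType K S]
    {n : ℕ} (hn : 0 < n) {tr : S →ₗ[F] F} {c : ℕ → S → F}
    (H : IsCH n tr c) (hnd : ∀ x, (∀ y, tr (x * y) = 0) → x = 0)
    (y y' : Fin (n ^ 2) → S) (hdet : (Matrix.of fun i j => tr (y i * y' j)).det ≠ 0) :
    ∃ f : S →+* Matrix (Fin n) (Fin n) K, Function.Surjective f ∧
      ∀ k, f (algebraMap K S k) = Matrix.scalar (Fin n) k := by
  have : CharZero F := charZero_of_injective_algebraMap (algebraMap K F).injective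
  have : Nontrivial S := by
    by_contra h
    rw [not_nontrivial_iff_subsingleton] at h
    have h1 := H.one
    rw [Subsingleton.elim (1 : S) 0, map_zero] at h1
    exact hn.ne' (by exact_mod_cast h1.symm)
  have : Module.Finite F S := CH_finite (K := K) hn H
  have hb : Function.Bijective (algebraMap K F) := base_eq (S := S)
  let φ : K ≃+* F := RingEquiv.ofBijective _ hb
  have : IsAlgClosed F := IsAlgClosed.of_ringEquiv K F φ
  have hli : LinearIndependent F y := by
    rw [Fintype.linearIndependent_iff]
    intro g hg
    have : Matrix.vecMul g (Matrix.of fun i j => tr (y i * y' j)) = 0 := by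
      ext j
      have h := congrArg (fun x => tr (x * y' j)) hg
      simp only [Finset.sum_mul, smul_mul_assoc, map_sum, map_smul, zero_mul, map_zero] at h
      simpa [Matrix.vecMul, dotProduct] using h
    exact congrFun (Matrix.eq_zero_of_vecMul_eq_zero hdet this)
  have hdim : n ^ 2 ≤ Module.finrank F S := by
    simpa using hli.fintype_card_le_finrank
  obtain ⟨f, hf⟩ := surj_matrix hn H hnd hdim
  refine ⟨(φ.symm.mapMatrix (m := Fin n) : _ →+* _).comp (f : S →+* Matrix (Fin n) (Fin n) F), ?_, ?_⟩
  · exact (φ.symm.mapMatrix (m := Fin n)).surjective.comp hf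
  · intro k
    have h1 : f (algebraMap K S k) = algebraMap F _ (φ k) := by
      rw [IsScalarTower.algebraMap_apply K F S, f.commutes]; rfl
    simp only [RingHom.comp_apply]
    erw [h1]
    ext i j
    simp [Matrix.algebraMap_matrix_apply, Matrix.diagonal_apply, apply_ite φ.symm]
end

section
section
variable {K C R V : Type*} [Field K] [IsAlgClosed K] [CharZero K] [CommRing C] [Ring R] [Algebra K C]
  [Algebra K R] [Algebra C R] [IsScalarTower K C R] [AddCommGroup V] [Module R V] [Module K V]
  [IsScalarTower K R V] [FiniteDimensional K V] [IsSimpleModule R V]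

lemma schur_scalar (g : Module.End R V) : ∃ μ : K, ∀ v, g v = μ • v := by
  have : Nontrivial V := IsSimpleModule.nontrivial R V
  let g' : Module.End K V := 
    { toFun := g
      map_add' := map_add g
      map_smul' := fun k v => by
        simp only [RingHom.id_apply]
        rw [← algebraMap_smul R k v, map_smul, algebraMap_smul] }
  obtain ⟨μ, hμ⟩ := Module.End.exists_eigenvalue g'
  obtain ⟨v, hv⟩ := hμ.exists_hasEigenvector
  let h : Module.End R V := 
    { toFun := fun v => g v - μ • v
      map_add' := fun v w => by rw [map_add, smul_add]; abel
      map_smul' := fun r v => by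
        simp only [RingHom.id_apply]
        rw [map_smul, smul_sub, ← algebraMap_smul R μ (r • v), ← algebraMap_smul R μ v, smul_smul,
          smul_smul, Algebra.commutes] }
  refine ⟨μ, fun w => ?_⟩
  rcases LinearMap.bijective_or_eq_zero h with hb | h0
  · exfalso
    refine hv.2 (hb.1 ?_)
    rw [map_zero]
    change g v - μ • v = 0
    exact sub_eq_zero.mpr hv.apply_eq_smul
  · exact sub_eq_zero.mp (LinearMap.congr_fun h0 w)

lemma burnside (f : Module.End K V) : ∃ r : R, ∀ v, r • v = f v := by
  classical
  let f' : Module.End (Module.End R V) V :=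
    { toFun := f
      map_add' := map_add f
      map_smul' := fun g v => by
        obtain ⟨μ, hμ⟩ := schur_scalar (K := K) g
        simp only [RingHom.id_apply, Module.End.smul_def, hμ, map_smul] }
  let b := Module.finBasis K V
  obtain ⟨r, hr⟩ := jacobson_density (R := R) f' (Finset.univ.image b)
  let r' : Module.End K V := Algebra.lsmul K K V r
  have : r' = f := b.ext fun i => (hr (b i) (by simp)).symm
  exact ⟨r, fun v => LinearMap.congr_fun this v⟩

theorem disc_of_rep {n : ℕ} (hn : 0 < n) (hV : Module.finrank K V = n)
    {tr : R →ₗ[C] C} {c : ℕ → R → C} (H : IsCH n tr c) (m : Ideal C) (hm : m.IsMaximal)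
    (hk : ∀ z ∈ m, ∀ v : V, algebraMap C R z • v = 0) :
    ∃ y : Fin (n ^ 2) → R, Matrix.det (Matrix.of fun i j => tr (y i * y j)) ∉ m := by
  classical
  have : Nontrivial V := IsSimpleModule.nontrivial R V
  obtain ⟨v0, hv0⟩ := exists_ne (0 : V)
  have hinj : ∀ {a b : K}, a • v0 = b • v0 → a = b := fun h => smul_left_injective K hv0 h
  have hex : ∀ z : C, ∃ μ : K, ∀ v : V, algebraMap C R z • v = μ • v := fun z =>
    schur_scalar (K := K) (R := R)
      { toFun := fun v => algebraMap C R z • v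
        map_add' := fun v w => smul_add _ v w
        map_smul' := fun r v => by
          simp only [RingHom.id_apply]
          rw [smul_smul, smul_smul, Algebra.commutes] }
  choose κ0 hκ0 using hex
  let κ : C →+* K :=
    { toFun := κ0
      map_one' := hinj (by rw [← hκ0, map_one, one_smul, one_smul])
      map_zero' := hinj (by rw [← hκ0, map_zero, zero_smul, zero_smul])
      map_add' := fun a b => hinj (by rw [← hκ0, map_add, add_smul, add_smul, hκ0, hκ0])
      map_mul' := fun a b => hinj (by rw [← hκ0, map_mul, mul_smul, mul_smul, hκ0, hκ0]) }
  have hκ : ∀ z (v : V), algebraMap C R z • v = κ z • v := hκ0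
  have hker : ∀ z, κ z ≠ 0 → z ∉ m := by
    intro z hz hzm
    have := hk z hzm v0
    rw [hκ] at this
    exact hz ((smul_eq_zero.mp this).resolve_right hv0)
  let b : Module.Basis (Fin n) K V := Module.finBasisOfFinrankEq K V hV
  have hr : ∀ i j : Fin n, ∃ r : R, ∀ k, r • b k = if j = k then b i else 0 := by
    intro i j
    obtain ⟨r, hr⟩ := burnside (R := R) (b.constr K (fun k => if j = k then b i else 0))
    exact ⟨r, fun k => by rw [hr, b.constr_basis]⟩
  choose r hr using hr
  let τ : R → K := fun x => κ (tr x)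
  have τadd : ∀ x y, τ (x + y) = τ x + τ y := fun x y => by simp [τ]
  have τcyc : ∀ x y, τ (x * y) = τ (y * x) := fun x y => by simp only [τ, H.cyc x y]
  have hD : ∃ d : R, ∀ k, d • b k = ((k : ℕ) : K) • b k := by
    obtain ⟨d, hd⟩ := burnside (R := R) (b.constr K (fun k => ((k : ℕ) : K) • b k))
    exact ⟨d, fun k => by rw [hd, b.constr_basis]⟩
  obtain ⟨d, hd⟩ := hD
  have hc1 : ∀ x, κ (c 1 x) = τ x := by
    intro x
    have := H.newton 1 le_rfl x
    simp [H.c0] at this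
    simp [τ, this]
  have hchar : ∀ x : R, (∀ k, x • b k = ((k : ℕ) : K) • b k) → ∀ k : Fin n,
      ∑ i ∈ Finset.range (n + 1), (-1 : K) ^ i * κ (c i x) * ((k : ℕ) : K) ^ (n - i) = 0 := by
    intro x hx k
    have hp : ∀ j, x ^ j • b k = ((k : ℕ) : K) ^ j • b k := by
      intro j
      induction j with
      | zero => simp
      | succ j ih => 
        rw [pow_succ', mul_smul, ih, ← algebraMap_smul R, smul_smul, ← Algebra.commutes, mul_smul,
          algebraMap_smul, hx, smul_smul, pow_succ]
    have h := congrArg (· • b k) (H.ch x)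
    simp only [zero_smul, Finset.sum_smul] at h
    have h2 : (∑ i ∈ Finset.range (n + 1), (-1 : K) ^ i * κ (c i x) * ((k : ℕ) : K) ^ (n - i)) • b k
        = 0 := by
      rw [← h, Finset.sum_smul]
      refine Finset.sum_congr rfl fun i _ => ?_
      symm
      rw [Algebra.smul_def, mul_smul, hp, hκ, smul_smul]
      simp
    exact (smul_eq_zero.mp h2).resolve_right (b.ne_zero k)
  have hτd : ∀ x x' : R, (∀ k, x • b k = ((k : ℕ) : K) • b k) →
      (∀ k, x' • b k = ((k : ℕ) : K) • b k) → τ x = τ x' := by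
    intro x x' hx hx'
    have h := vander_lt (K := K) (C := K) (⊥ : Submodule K K) n
      (fun l => (-1 : K) ^ (n - l) * (κ (c (n - l) x) - κ (c (n - l) x'))) (fun t ht => by
        have h1 := hchar x hx ⟨t, ht⟩
        have h2 := hchar x' hx' ⟨t, ht⟩
        rw [Submodule.mem_bot, ← sub_self (0 : K)]
        nth_rw 1 [← h1]
        rw [← h2, ← Finset.sum_sub_distrib]
        rw [← Finset.sum_range_reflect _ (n + 1), Finset.sum_range_succ]
        simp only [Nat.add_sub_cancel, Nat.sub_self, H.c0, sub_self, add_zero]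
        refine Finset.sum_congr rfl fun l hl => ?_
        have hl' := Finset.mem_range.mp hl
        rw [show n - (n - l) = l by omega]
        simp only [smul_eq_mul]
        ring) (n - 1) (by omega)
    rw [Submodule.mem_bot, show n - (n - 1) = 1 by omega] at h
    rw [← hc1, ← hc1]
    have h' : κ (c 1 x') = κ (c 1 x) := by simpa [sub_eq_zero] using h
    exact h'.symm
  have hτker : ∀ a : R, (∀ k, a • b k = 0) → τ a = 0 := by
    intro a ha
    have h := hτd (a + d) d (fun k => by rw [add_smul, ha, hd, zero_add]) hd
    rw [τadd] at h
    simpa using h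
  have hτeq : ∀ x y : R, (∀ k, x • b k = y • b k) → τ x = τ y := by
    intro x y h
    have h1 := hτker (x - y) (fun k => by rw [sub_smul, h, sub_self])
    have h2 := τadd (x - y) y
    rw [h1, zero_add, sub_add_cancel] at h2
    exact h2
  have hmul : ∀ i j k l, τ (r i j * r k l) = if j = k then τ (r i l) else 0 := by
    intro i j k l
    split_ifs with h
    · subst h
      refine hτeq _ _ fun p => ?_
      rw [mul_smul, hr, hr]
      split_ifs
      · rw [hr, if_pos rfl]
      · rw [smul_zero]
    · refine hτker _ fun p => ?_
      rw [mul_smul, hr]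
      split_ifs
      · rw [hr, if_neg h]
      · rw [smul_zero]
  have hoff : ∀ i j, i ≠ j → τ (r i j) = 0 := by
    intro i j h
    have h1 := hmul i i i j
    rw [if_pos rfl] at h1
    rw [← h1, τcyc, hmul, if_neg h.symm]
  have hdiag : ∀ i j, τ (r i i) = τ (r j j) := by
    intro i j
    have h1 := hmul i j j i
    have h2 := hmul j i i j
    rw [if_pos rfl] at h1 h2
    rw [← h1, ← h2, τcyc]
  have hone : ∀ i, τ (r i i) = 1 := by
    intro i
    have h1 : τ (∑ j, r j j) = τ 1 := by
      refine hτeq _ _ fun k => ?_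
      rw [Finset.sum_smul, one_smul]
      simp [hr]
    have h2 : τ (∑ j, r j j) = ∑ j : Fin n, τ (r j j) := by simp [τ]
    have h3 : τ 1 = n := by simp [τ, H.one]
    rw [h2, h3, Finset.sum_congr rfl (g := fun _ => τ (r i i)) (fun j _ => hdiag j i)] at h1
    simp only [Finset.sum_const, Finset.card_univ, Fintype.card_fin, nsmul_eq_mul] at h1
    have hn0 : (n : K) ≠ 0 := by exact_mod_cast hn.ne'
    exact mul_left_cancel₀ hn0 (by rw [h1, mul_one])
  have hτr : ∀ i j, τ (r i j) = if i = j then 1 else 0 := by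
    intro i j
    split_ifs with h
    · subst h; exact hone i
    · exact hoff i j h
  let e : Fin (n ^ 2) ≃ Fin n × Fin n := (finCongr (pow_two n)).trans finProdFinEquiv.symm
  refine ⟨fun i => r (e i).1 (e i).2, hker _ ?_⟩
  let M : Matrix (Fin n × Fin n) (Fin n × Fin n) K := fun x y => τ (r x.1 x.2 * r y.1 y.2)
  have hM : κ (Matrix.det (Matrix.of fun i j => tr (r (e i).1 (e i).2 * r (e j).1 (e j).2))) = M.det := by
    rw [RingHom.map_det, ← Matrix.det_submatrix_equiv_self e]
    rfl
  rw [hM]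
  have hMM : M * M = 1 := by
    ext ⟨i, j⟩ ⟨k, l⟩
    rw [Matrix.mul_apply, Fintype.sum_prod_type]
    simp only [M, hmul, hτr, Matrix.one_apply, Prod.mk.injEq]
    rw [Finset.sum_eq_single j, Finset.sum_eq_single i]
    · by_cases h1 : i = k <;> by_cases h2 : j = l <;> simp [h1, h2, eq_comm]
    · intro p _ hp
      simp [hp.symm]
    · simp
    · intro p _ hp
      simp [hp.symm]
    · simp
  intro h0
  have := congrArg Matrix.det hMM
  rw [Matrix.det_mul, h0, Matrix.det_one, zero_mul] at this
  exact zero_ne_one this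
end
end

section
theorem exists_matrix_rep_aux
    {K C R F S : Type u} [Field F] [Ring S] [Field K] [IsAlgClosed K] [CharZero K]
    [CommRing C] [Ring R] [Algebra K C] [Algebra K R] [Algebra C R] [IsScalarTower K C R]
    [Algebra.FiniteType K R]
    {n : ℕ} (hn : 0 < n) {tr : R →ₗ[C] C} {c : ℕ → R → C} (H : IsCH n tr c)
    (m : Ideal C) (ρ : R →+* S) (π : C →+* F)
    (hρ : Function.Surjective ρ) (hπ : Function.Surjective π)
    (hN : ∀ x, ρ x = 0 ↔ ∀ w, tr (x * w) ∈ m) (hm0 : ∀ z, π z = 0 ↔ z ∈ m) (y y' : Fin (n ^ 2) → R)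
    (hdet : Matrix.det (Matrix.of fun i j => tr (y i * y' j)) ∉ m) :
    ∃ f : R →+* Matrix (Fin n) (Fin n) K, Function.Surjective f ∧
      (∀ k, f (algebraMap K R k) = Matrix.scalar (Fin n) k) ∧
      ∀ z ∈ m, f (algebraMap C R z) = 0 := by
  have hmN : ∀ z ∈ m, ρ (algebraMap C R z) = 0 := by
    intro z hz
    refine (hN _).mpr fun w => ?_
    rw [← Algebra.smul_def, map_smul]
    exact Ideal.mul_mem_right _ _ hz
  let ι : F →+* S := RingHom.liftOfSurjective π hπ ⟨ρ.comp (algebraMap C R), fun z hz => hmN z ((hm0 z).mp hz)⟩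
  have hι : ∀ z, ι (π z) = ρ (algebraMap C R z) := fun z => RingHom.liftOfRightInverse_comp_apply _ _ _ _ _
  letI algF : Algebra (F) (S) := RingHom.toAlgebra' ι (by
    intro z x
    obtain ⟨z, rfl⟩ := hπ z
    obtain ⟨x, rfl⟩ := hρ x
    rw [hι, ← map_mul, ← map_mul, Algebra.commutes])
  have hsmul : ∀ z x, π z • ρ x = ρ (z • x) := by
    intro z x
    rw [Algebra.smul_def, Algebra.smul_def, map_mul, ← hι]
    rfl
  letI algK : Algebra K (S) := RingHom.toAlgebra' (ρ.comp (algebraMap K R)) (by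
    intro z x
    obtain ⟨x, rfl⟩ := hρ x
    rw [RingHom.comp_apply, ← map_mul, ← map_mul, Algebra.commutes])
  letI algKF : Algebra K (F) := RingHom.toAlgebra (π.comp (algebraMap K C))
  have : IsScalarTower K (F) (S) := IsScalarTower.of_algebraMap_eq fun k => by
    change ρ (algebraMap K R k) = ι (π (algebraMap K C k))
    rw [hι, ← IsScalarTower.algebraMap_apply]
  have : Algebra.FiniteType K (S) :=
    Algebra.FiniteType.of_surjective
      ({ ρ with commutes' := fun _ => rfl } : R →ₐ[K] S) hρ
  let σ := Function.surjInv hρ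
  have hσ : ∀ s, ρ (σ s) = s := Function.surjInv_eq hρ
  have hwd : ∀ x, π (tr (σ (ρ x))) = π (tr x) := by
    intro x
    have h1 : ρ (σ (ρ x)) = ρ x := hσ _
    have h2 := (hN _).mp (by rw [map_sub, h1, sub_self] : ρ (σ (ρ x) - x) = 0) 1
    rw [mul_one, map_sub] at h2
    have h3 := (hm0 _).mpr h2
    rwa [map_sub, sub_eq_zero] at h3
  let τ : S →ₗ[F] F :=
    { toFun := fun s => π (tr (σ s))
      map_add' := fun s t => by
        obtain ⟨s, rfl⟩ := hρ s
        obtain ⟨t, rfl⟩ := hρ t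
        rw [← map_add, hwd, hwd, hwd, map_add, map_add]
      map_smul' := fun z s => by
        obtain ⟨s, rfl⟩ := hρ s
        obtain ⟨z, rfl⟩ := hπ z
        rw [hsmul, hwd, hwd, map_smul, smul_eq_mul, map_mul]
        rfl }
  have hτ : ∀ x, τ (ρ x) = π (tr x) := hwd
  let c' : ℕ → S → F := fun i s => π (c i (σ s))
  have H' : IsCH n τ c' :=
    { cyc := fun s t => by
        obtain ⟨s, rfl⟩ := hρ s
        obtain ⟨t, rfl⟩ := hρ t
        rw [← map_mul, ← map_mul, hτ, hτ, H.cyc]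
      one := by rw [← map_one ρ, hτ, H.one, map_natCast]
      c0 := fun s => by simp only [c', H.c0, map_one]
      newton := fun i hi s => by
        have h := congrArg π (H.newton i hi (σ s))
        rw [map_mul, map_natCast, map_sum] at h
        rw [show c' i s = π (c i (σ s)) from rfl, h]
        refine Finset.sum_congr rfl fun j _ => ?_
        rw [map_mul, map_mul, map_pow, map_neg, map_one, ← hτ, map_pow, hσ]
      ch := fun s => by
        have h := congrArg ρ (H.ch (σ s))
        rw [map_zero, map_sum] at h
        rw [← h]
        refine Finset.sum_congr rfl fun j _ => ?_
        rw [← hsmul, map_mul, map_pow, map_neg, map_one, map_pow, hσ] }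
  have hnd : ∀ x, (∀ w, τ (x * w) = 0) → x = 0 := by
    intro x hx
    obtain ⟨x, rfl⟩ := hρ x
    refine (hN _).mpr fun w => ?_
    have := hx (ρ w)
    rw [← map_mul, hτ] at this
    exact (hm0 _).mp this
  obtain ⟨f, hf, hfk⟩ := core (K := K) hn H' hnd (fun i => ρ (y i)) (fun i => ρ (y' i)) (by
    intro h0
    refine hdet ((hm0 _).mp ?_)
    change π _ = 0
    rw [RingHom.map_det, ← h0]
    congr 1
    ext i j
    simp only [RingHom.mapMatrix_apply, Matrix.map_apply, Matrix.of_apply]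
    rw [← map_mul, hτ])
  refine ⟨f.comp ρ, hf.comp hρ, hfk, fun z hz => ?_⟩
  rw [RingHom.comp_apply, hmN z hz, map_zero]

theorem exists_matrix_rep
    {K C R : Type u} [Field K] [IsAlgClosed K] [CharZero K]
    [CommRing C] [Ring R] [Algebra K C] [Algebra K R] [Algebra C R] [IsScalarTower K C R]
    [Algebra.FiniteType K R]
    {n : ℕ} (hn : 0 < n) {tr : R →ₗ[C] C} {c : ℕ → R → C} (H : IsCH n tr c)
    (m : Ideal C) (hm : m.IsMaximal) (y y' : Fin (n ^ 2) → R)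
    (hdet : Matrix.det (Matrix.of fun i j => tr (y i * y' j)) ∉ m) :
    ∃ f : R →+* Matrix (Fin n) (Fin n) K, Function.Surjective f ∧
      (∀ k, f (algebraMap K R k) = Matrix.scalar (Fin n) k) ∧
      ∀ z ∈ m, f (algebraMap C R z) = 0 := by
  let N : Ideal R :=
    { carrier := {x | ∀ w, tr (x * w) ∈ m}
      zero_mem' := fun w => by simp
      add_mem' := fun {a b} ha hb w => by rw [add_mul, map_add]; exact add_mem (ha w) (hb w)
      smul_mem' := fun r x hx w => by
        rw [smul_eq_mul, mul_assoc, H.cyc, mul_assoc]; exact hx _ }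
  have hN : ∀ x, x ∈ N ↔ ∀ w, tr (x * w) ∈ m := fun _ => Iff.rfl
  have : N.IsTwoSided := ⟨fun {a} b ha w => by rw [mul_assoc]; exact ha _⟩
  letI : Field (C ⧸ m) := Ideal.Quotient.field m
  exact exists_matrix_rep_aux hn H m (Ideal.Quotient.mk N) (Ideal.Quotient.mk m)
    Ideal.Quotient.mk_surjective Ideal.Quotient.mk_surjective
    (fun x => Ideal.Quotient.eq_zero_iff_mem.trans (hN x))
    (fun z => Ideal.Quotient.eq_zero_iff_mem) y y' hdet
end

theorem rep_of_matrix {K R : Type u} [Field K] [Ring R] [Algebra K R] {n : ℕ} (hn : 0 < n)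
    (f : R →+* Matrix (Fin n) (Fin n) K) (hf : Function.Surjective f)
    (hk : ∀ k, f (algebraMap K R k) = Matrix.scalar (Fin n) k) :
    ∃ V : ModRep R, IsSimpleModule R V.carrier ∧ repFinDim K V ∧ repDim K V = n ∧
      ∀ r, f r = 0 → ∀ v : V.carrier, r • v = 0 := by
  let g : R →+* Module.End K (Fin n → K) :=
    (Matrix.toLinAlgEquiv' (R := K) (n := Fin n)).toAlgHom.toRingHom.comp f
  have hg : ∀ r v, g r v = Matrix.mulVec (f r) v := fun r v => rfl
  letI instR : Module R (Fin n → K) := Module.compHom (Fin n → K) g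
  have hs : ∀ (r : R) (v : Fin n → K), r • v = Matrix.mulVec (f r) v := fun r v => rfl
  have hmod : Module.compHom (Fin n → K) (algebraMap K R) = Pi.module (Fin n) (fun _ => K) K := by
    refine Module.ext' _ _ fun k v => ?_
    change Matrix.mulVec (f (algebraMap K R k)) v = k • v
    rw [hk]
    ext i
    simp [Matrix.mulVec_diagonal]
  refine ⟨⟨Fin n → K⟩, ?_, ?_, ?_, ?_⟩
  · have : Nonempty (Fin n) := ⟨⟨0, hn⟩⟩
    change IsSimpleModule R (Fin n → K)
    rw [isSimpleModule_iff_toSpanSingleton_surjective]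
    refine ⟨inferInstance, fun v hv w => ?_⟩
    obtain ⟨i, hi⟩ := Function.ne_iff.mp hv
    obtain ⟨r, hr⟩ := hf (Matrix.of fun j k => if k = i then w j / v i else 0)
    refine ⟨r, ?_⟩
    rw [LinearMap.toSpanSingleton_apply, hs, hr]
    ext j
    have hi' : v i ≠ 0 := hi
    simp [Matrix.mulVec, dotProduct, hi']
  · change @FiniteDimensional K (Fin n → K) _ _ (Module.compHom (Fin n → K) (algebraMap K R))
    rw [hmod]
    infer_instance
  · change @Module.finrank K (Fin n → K) _ _ (Module.compHom (Fin n → K) (algebraMap K R)) = n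
    rw [hmod]
    simp
  · intro r hr v
    change Matrix.mulVec (f r) v = 0
    rw [hr, Matrix.zero_mulVec]

/-- **Theorem 4.1(a) of Brown–Yakimov**: let `R` be a Cayley–Hamilton algebra of degree `n`
with trace `tr : R → C` over an algebraically closed field `K` of characteristic `0`. Then
the zero sets of the `n²`-discriminant ideal and the modified `n²`-discriminant ideal of `R`
over `C` coincide and equal the complement of the Azumaya locus, where the Azumaya locus is
the set of maximal ideals `m` of `C` such that `R` has an `n`-dimensional irreducible
representation annihilated by `m`. -/
theorem cayley_hamilton_azumaya_locus
    {K C R : Type u} [Field K] [IsAlgClosed K] [CharZero K]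
    [CommRing C] [Ring R] [Algebra K C] [Algebra K R] [Algebra C R] [IsScalarTower K C R]
    (hinj : Function.Injective (algebraMap C R))
    [Algebra.FiniteType K R]
    (n : ℕ) (hn : 0 < n)
    (tr : R →ₗ[C] C) (htr0 : tr ≠ 0) (hcyc : ∀ x y : R, tr (x * y) = tr (y * x))
    (htr1 : tr 1 = (n : C))
    -- the Cayley–Hamilton identity of degree `n`: the characteristic coefficients
    -- `c i a = ĉ_i(a)` are determined from the Newton identities by the power sums
    -- `tr (a^j)`, and every `a : R` satisfies its characteristic polynomial
    (c : ℕ → R → C)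
    (hc0 : ∀ a : R, c 0 a = 1)
    (hcrec : ∀ i : ℕ, 1 ≤ i → ∀ a : R,
      (i : C) * c i a = ∑ j ∈ Finset.Icc 1 i, (-1 : C) ^ (j - 1) * c (i - j) a * tr (a ^ j))
    (hCH : ∀ a : R, ∑ i ∈ Finset.range (n + 1), ((-1 : C) ^ i * c i a) • a ^ (n - i) = 0)
    :
    maxZeroLocus (discIdeal (n ^ 2) tr) = maxZeroLocus (mdiscIdeal (n ^ 2) tr) ∧
    maxZeroLocus (discIdeal (n ^ 2) tr) =
      { m : Ideal C | m.IsMaximal ∧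
        ¬ ∃ V : ModRep R, IsSimpleModule R V.carrier ∧ repFinDim K V ∧
            repDim K V = n ∧ killedBy V m } := by
  have H : IsCH n tr c := ⟨hcyc, htr1, hc0, hcrec, hCH⟩
  have hA : ∀ m : Ideal C, m.IsMaximal → discIdeal (n ^ 2) tr ≤ m →
      ¬ ∃ V : ModRep R, IsSimpleModule R V.carrier ∧ repFinDim K V ∧
            repDim K V = n ∧ killedBy V m := by
    rintro m hm hle ⟨V, hs, hfd, hd, hkill⟩
    letI : Module K V.carrier := Module.compHom V.carrier (algebraMap K R)
    have : IsScalarTower K R V.carrier := ⟨fun k r v => by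
      rw [Algebra.smul_def, mul_smul]; rfl⟩
    have : FiniteDimensional K V.carrier := hfd
    obtain ⟨y, hy⟩ := disc_of_rep (K := K) (V := V.carrier) hn hd H m hm hkill
    exact hy (hle (Ideal.subset_span ⟨y, rfl⟩))
  have hB : ∀ m : Ideal C, m.IsMaximal → ¬ mdiscIdeal (n ^ 2) tr ≤ m →
      ∃ V : ModRep R, IsSimpleModule R V.carrier ∧ repFinDim K V ∧
            repDim K V = n ∧ killedBy V m := by
    intro m hm hle
    have : ∃ y y' : Fin (n ^ 2) → R,
        Matrix.det (Matrix.of fun i j => tr (y i * y' j)) ∉ m := by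
      by_contra hcon
      refine hle (Ideal.span_le.mpr ?_)
      rintro d ⟨y, y', rfl⟩
      by_contra hd
      exact hcon ⟨y, y', hd⟩
    obtain ⟨y, y', hdet⟩ := this
    obtain ⟨f, hf, hk, hz⟩ := exists_matrix_rep (K := K) hn H m hm y y' hdet
    obtain ⟨V, h1, h2, h3, h4⟩ := rep_of_matrix hn f hf hk
    exact ⟨V, h1, h2, h3, fun z hzm v => h4 _ (hz z hzm) v⟩
  have hDM : discIdeal (n ^ 2) tr ≤ mdiscIdeal (n ^ 2) tr := by
    refine Ideal.span_mono ?_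
    rintro d ⟨y, rfl⟩
    exact ⟨y, y, rfl⟩
  refine ⟨?_, ?_⟩
  · ext m
    refine ⟨fun ⟨hm, h⟩ => ⟨hm, ?_⟩, fun ⟨hm, h⟩ => ⟨hm, hDM.trans h⟩⟩
    by_contra hcon
    exact hA m hm h (hB m hm hcon)
  · ext m
    refine ⟨fun ⟨hm, h⟩ => ⟨hm, hA m hm h⟩, fun ⟨hm, h⟩ => ⟨hm, ?_⟩⟩
    by_contra hcon
    exact h (hB m hm fun h' => hcon (hDM.trans h'))
end
end
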